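/- Assume that k ⊆ Ω is finitely generated over ℚ as a field and that D ⊆ Ω is a finitely generated k-algebra. Then every basic open subset of Hom_k(D,k̄) is nonempty. -/

import Mathlib

set_option linter.unusedSectionVars false
set_option linter.unusedVariables false

set_option linter.unusedSectionVars false
set_option linter.unusedVariables false

section Base

variable {Ω : Type*} [Field Ω] [IsAlgClosed Ω] [CharZero Ω]
variable (k : Type*) [Field k] [Algebra k Ω]
variable (kbar : Type*) [Field kbar] [Algebra k kbar] [IsAlgClosure k kbar]

/-- `Γ` is (the carrier set of) a finitely generated subgroup of the additive group `(Ω,+)`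
or of the multiplicative group `(Ω∖{0},·)`. -/
def IsFGAddOrMulSubgroup (Γ : Set Ω) : Prop :=
  (∃ H : AddSubgroup Ω, H.FG ∧ Γ = (H : Set Ω)) ∨
  (∃ H : Subgroup Ωˣ, H.FG ∧ Γ = Units.val '' (H : Set Ωˣ))

/-- The `D`-subalgebra `D[Γ]` of `Ω` generated by `Γ`. -/
def algAdj (D : Subalgebra k Ω) (Γ : Set Ω) : Subalgebra k Ω :=
  Algebra.adjoin k ((D : Set Ω) ∪ Γ)

theorem le_algAdj (D : Subalgebra k Ω) (Γ : Set Ω) : D ≤ algAdj k D Γ :=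
  fun _ hx => Algebra.subset_adjoin (Set.mem_union_left _ hx)

theorem subset_algAdj (D : Subalgebra k Ω) (Γ : Set Ω) :
    Γ ⊆ (algAdj k D Γ : Set Ω) :=
  fun _ hx => Algebra.subset_adjoin (Set.mem_union_right _ hx)

/-- `ℬ(D,Γ)`: restrictions to `D` of the `k`-homomorphisms `D[Γ] → k̄` injective on `Γ`. -/
def specB (D : Subalgebra k Ω) (Γ : Set Ω) : Set (↥D →ₐ[k] kbar) :=
  { φ | ∃ ψ : ↥(algAdj k D Γ) →ₐ[k] kbar,
      (∀ (a b : Ω) (ha : a ∈ Γ) (hb : b ∈ Γ),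
        ψ ⟨a, subset_algAdj k D Γ ha⟩ = ψ ⟨b, subset_algAdj k D Γ hb⟩ → a = b) ∧
      ψ.comp (Subalgebra.inclusion (le_algAdj k D Γ)) = φ }

/-- A basic open subset of `Hom_k(D,k̄)`: a finite intersection of sets `ℬ(D,Γ)`. -/
def IsBasicOpen (D : Subalgebra k Ω) (U : Set (↥D →ₐ[k] kbar)) : Prop :=
  ∃ s : Finset (Set Ω), s.Nonempty ∧ (∀ Γ ∈ s, IsFGAddOrMulSubgroup Γ) ∧
    U = ⋂ Γ ∈ s, specB k kbar D Γ

/-- The Zariski closed subset `𝒱(I)` of `Hom_k(D,k̄)`. -/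
def specV (D : Subalgebra k Ω) (I : Ideal ↥D) : Set (↥D →ₐ[k] kbar) :=
  { φ | ∀ a ∈ I, φ a = 0 }

/-- Density in the Zariski topology on `Hom_k(D,k̄)` (whose closed sets are the `𝒱(I)`). -/
def ZariskiDense (D : Subalgebra k Ω) (U : Set (↥D →ₐ[k] kbar)) : Prop :=
  ∀ I : Ideal ↥D, U ⊆ specV k kbar D I → specV k kbar D I = Set.univ

end Base

namespace Specialization

open Polynomial

section Valuations

variable {L Γ₀ : Type*} [Field L] [LinearOrderedCommGroupWithZero Γ₀]

/-- Roots of a monic polynomial are bounded by a common bound `≥ 1` of the coefficients. -/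
theorem valuation_root_le (v : Valuation L Γ₀) {p : L[X]} (hp : p.Monic) {y : L}
    (hy : p.eval y = 0) {C : Γ₀} (hC : 1 ≤ C) (h : ∀ i, v (p.coeff i) ≤ C) : v y ≤ C := by
  by_contra! hlt
  have hn : p.natDegree ≠ 0 := by
    intro h0
    rw [hp.natDegree_eq_zero.1 h0] at hy
    simp at hy
  obtain ⟨n, hn⟩ := Nat.exists_eq_succ_of_ne_zero hn
  have hy0 : 0 < v y := lt_of_le_of_lt zero_le hlt
  have h1y : 1 < v y := lt_of_le_of_lt hC hlt
  rw [eval_eq_sum_range, hn, Finset.sum_range_succ] at hy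
  have hlead : p.coeff (n + 1) = 1 := by
    have := hp.coeff_natDegree
    rwa [hn] at this
  rw [hlead, one_mul] at hy
  have h1 : v (∑ i ∈ Finset.range (n + 1), p.coeff i * y ^ i) < v (y ^ (n + 1)) := by
    rw [map_pow]
    refine v.map_sum_lt (pow_ne_zero _ hy0.ne') fun i hi => ?_
    rw [Finset.mem_range] at hi
    rw [map_mul, map_pow, pow_succ']
    calc v (p.coeff i) * v y ^ i ≤ C * v y ^ n :=
          mul_le_mul' (h i) (pow_le_pow_right₀ h1y.le (by lia))
      _ < v y * v y ^ n := mul_lt_mul_of_pos_right hlt (pow_pos hy0 n)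
  have := v.map_add_eq_of_lt_right h1
  rw [hy, map_zero, map_pow] at this
  exact (pow_ne_zero _ hy0.ne') this.symm

/-- Dominance of the leading term for a large argument. -/
theorem valuation_eval_of_one_lt (v : Valuation L Γ₀) {p : L[X]} {t : L} (ht : 1 < v t)
    (h : ∀ i, v (p.coeff i) ≤ 1) (hl : v p.leadingCoeff = 1) :
    v (p.eval t) = v t ^ p.natDegree := by
  rw [eval_eq_sum_range, Finset.sum_range_succ]
  have ht0 : v t ≠ 0 := (zero_lt_one.trans ht).ne'
  have h2 : v (p.coeff p.natDegree * t ^ p.natDegree) = v t ^ p.natDegree := by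
    rw [map_mul, map_pow]
    change v p.leadingCoeff * _ = _
    rw [hl, one_mul]
  rw [v.map_add_eq_of_lt_right, h2]
  rw [h2]
  refine v.map_sum_lt (pow_ne_zero _ ht0) fun i hi => ?_
  rw [map_mul, map_pow]
  refine (mul_le_of_le_one_left' (h i)).trans_lt ?_
  exact pow_lt_pow_right₀ ht (Finset.mem_range.1 hi)

/-- Terms with pairwise distinct valuations are independent. -/
theorem exists_valuation_eq_sum (v : Valuation L Γ₀) {ι : Type*} (s : Finset ι) (a : ι → L)
    (hinj : ∀ i ∈ s, ∀ j ∈ s, a i ≠ 0 → a j ≠ 0 → v (a i) = v (a j) → i = j) {i : ι} (hi : i ∈ s) (h0 : a i ≠ 0) :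
    ∃ j ∈ s, a j ≠ 0 ∧ v (∑ i ∈ s, a i) = v (a j) ∧ ∀ i ∈ s, v (a i) ≤ v (a j) := by
  classical
  obtain ⟨j, hj, hmax⟩ := s.exists_max_image (fun i => v (a i)) ⟨i, hi⟩
  have hj0 : a j ≠ 0 := by
    intro hj0
    have := hmax i hi
    simp [hj0, h0] at this
  refine ⟨j, hj, hj0, ?_, hmax⟩
  refine v.map_sum_eq_of_lt hj fun i hi => ?_
  simp only [Finset.mem_sdiff, Finset.mem_singleton] at hi
  refine lt_of_le_of_ne (hmax i hi.1) fun he => hi.2 ?_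
  refine hinj i hi.1 j hj ?_ hj0 he
  intro h; rw [h, map_zero] at he; exact hj0 ((map_eq_zero v).1 he.symm)

theorem eq_zero_of_sum_eq_zero_of_valuation_ne (v : Valuation L Γ₀) {ι : Type*} (s : Finset ι)
    (a : ι → L)
    (hinj : ∀ i ∈ s, ∀ j ∈ s, a i ≠ 0 → a j ≠ 0 → v (a i) = v (a j) → i = j)
    (h : ∑ i ∈ s, a i = 0) : ∀ i ∈ s, a i = 0 := by
  intro i hi
  by_contra h0
  obtain ⟨j, -, hj0, hj, -⟩ := exists_valuation_eq_sum v s a hinj hi h0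
  rw [h, map_zero] at hj
  exact hj0 ((map_eq_zero v).1 hj.symm)

end Valuations

end Specialization

namespace Specialization

open Polynomial IsDedekindDomain

/-- A valuation subring of a subfield is the trace of a valuation subring of the field. -/
theorem exists_valuationSubring_extension {F K : Type*} [Field F] [Field K] [Algebra F K]
    (A : ValuationSubring F) :
    ∃ W : ValuationSubring K, ∀ f : F, algebraMap F K f ∈ W ↔ f ∈ A := by
  obtain ⟨W, hle, hloc⟩ := LocalSubring.exists_le_valuationSubring
    (A.toLocalSubring.map (algebraMap F K))
  have hsub : ∀ f ∈ A, algebraMap F K f ∈ W := fun f hf => hle ⟨f, hf, rfl⟩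
  refine ⟨W, fun f => ⟨fun hf => ?_, hsub f⟩⟩
  by_contra hfA
  have hf0 : f ≠ 0 := fun h => hfA (h ▸ A.zero_mem)
  have hinv : f⁻¹ ∈ A := (A.mem_or_inv_mem f).resolve_left hfA
  let x : (A.toLocalSubring.map (algebraMap F K)).toSubring := ⟨algebraMap F K f⁻¹, f⁻¹, hinv, rfl⟩
  have hu : IsUnit (Subring.inclusion hle x) := by
    refine IsUnit.of_mul_eq_one ⟨algebraMap F K f, hf⟩ (Subtype.ext ?_)
    change algebraMap F K f⁻¹ * algebraMap F K f = 1
    rw [← map_mul, inv_mul_cancel₀ hf0, map_one]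
  obtain ⟨y, hy⟩ := (hloc.map_nonunit x hu).exists_right_inv
  obtain ⟨g, hg, hgy⟩ := y.2
  have : f⁻¹ * g = 1 := by
    apply (algebraMap F K).injective
    have := congrArg Subtype.val hy
    rw [map_mul, map_one]
    rw [hgy]
    exact this
  have : f = g := by field_simp at this; exact this.symm
  exact hfA (this ▸ hg)

theorem heightOneSpectrum_infinite_of_isIntegral (B C : Type*) [CommRing B] [IsDomain B]
    [CommRing C] [IsDomain C] [Algebra B C] [FaithfulSMul B C] [Algebra.IsIntegral B C]
    [Infinite (HeightOneSpectrum B)] : Infinite (HeightOneSpectrum C) := by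
  have hinj : Function.Injective (algebraMap B C) := FaithfulSMul.algebraMap_injective B C
  have key : ∀ P : HeightOneSpectrum B, ∃ Q : HeightOneSpectrum C,
      Q.asIdeal.comap (algebraMap B C) = P.asIdeal := by
    intro P
    have := P.isPrime
    obtain ⟨Q, hQ, hQP⟩ := Ideal.exists_ideal_over_prime_of_isIntegral_of_isDomain (S := C)
      P.asIdeal (by rw [(RingHom.injective_iff_ker_eq_bot _).1 hinj]; exact bot_le)
    refine ⟨⟨Q, hQ, ?_⟩, hQP⟩
    rintro rfl
    apply P.ne_bot
    rw [← hQP]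
    exact (RingHom.injective_iff_ker_eq_bot _).1 hinj
  choose f hf using key
  exact Infinite.of_injective f fun P Q h => HeightOneSpectrum.ext (by rw [← hf P, h, hf Q])

theorem heightOneSpectrum_not_le {R : Type*} [CommRing R] [IsDedekindDomain R]
    {P Q : HeightOneSpectrum R} (h : P ≠ Q) : ∃ x ∈ P.asIdeal, x ∉ Q.asIdeal := by
  by_contra! hle
  exact h (HeightOneSpectrum.ext (P.isMaximal.eq_of_le Q.isPrime.ne_top hle))

/-- Two independent valuations on a field which is algebraic over the fraction field of
a Dedekind domain with infinitely many primes. -/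
theorem exists_two_valuations_of_isDedekindDomain {B F₀ K : Type*} [CommRing B]
    [IsDedekindDomain B] [Infinite (HeightOneSpectrum B)] [Field F₀] [CharZero F₀]
    [Algebra B F₀] [IsFractionRing B F₀] [Field K] [Algebra F₀ K] [Algebra.IsAlgebraic F₀ K]
    {S : Set K} (hS : S.Finite) :
    ∃ (F : Subfield K) (W₀ W₁ : ValuationSubring K) (ϖ u : K), S ⊆ F ∧ ϖ ∈ F ∧ u ∈ F ∧
      (∀ s ∈ S, s ≠ 0 → W₀.valuation s = 1 ∧ W₁.valuation s = 1) ∧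
      W₀.valuation ϖ < 1 ∧ W₁.valuation ϖ = 1 ∧ W₀.valuation u = 1 ∧ W₁.valuation u < 1 ∧
      ϖ ≠ 0 ∧
      ∀ c ∈ F, c ≠ 0 → ∀ M n : ℕ, W₀.valuation c ^ M = W₀.valuation ϖ ^ n → M ∣ n := by
  classical
  let F := IntermediateField.adjoin F₀ S
  have : FiniteDimensional F₀ F := by
    have : Finite S := hS
    exact IntermediateField.finiteDimensional_adjoin fun x _ => Algebra.IsIntegral.isIntegral x
  let : Algebra B F := ((algebraMap F₀ F).comp (algebraMap B F₀)).toAlgebra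
  have : IsScalarTower B F₀ F := IsScalarTower.of_algebraMap_eq fun _ => rfl
  let C := integralClosure B F
  have : IsDedekindDomain C := integralClosure.isDedekindDomain B F₀ F
  have : IsFractionRing C F := integralClosure.isFractionRing_of_finite_extension F₀ F
  have : FaithfulSMul B F := by
    rw [faithfulSMul_iff_algebraMap_injective]
    exact (algebraMap F₀ F).injective.comp (IsFractionRing.injective B F₀)
  have : FaithfulSMul B C := by
    rw [faithfulSMul_iff_algebraMap_injective]
    intro x y h
    exact FaithfulSMul.algebraMap_injective B F (congrArg Subtype.val h)
  have : Algebra.IsIntegral B C := inferInstance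
  have := heightOneSpectrum_infinite_of_isIntegral B C
  have hbad : {P : HeightOneSpectrum C | ∃ s : F, (s : K) ∈ S ∧ s ≠ 0 ∧
      P.valuation F s ≠ 1}.Finite := by
    have hS' : {s : F | (s : K) ∈ S}.Finite := hS.preimage Subtype.val_injective.injOn
    refine (hS'.biUnion (t := fun s => HeightOneSpectrum.Support C s ∪
      HeightOneSpectrum.Support C s⁻¹) fun s _ =>
      (HeightOneSpectrum.Support.finite C s).union (HeightOneSpectrum.Support.finite C s⁻¹)).subset ?_
    rintro P ⟨s, hs, hs0, hP⟩
    refine Set.mem_biUnion hs ?_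
    rcases lt_or_gt_of_ne hP with h | h
    · right
      change 1 < P.valuation F s⁻¹
      rw [map_inv₀]
      exact (one_lt_inv₀ (zero_lt_iff.2 ((Valuation.ne_zero_iff _).2 hs0))).2 h
    · left; exact h
  obtain ⟨P, hP⟩ := hbad.infinite_compl.nonempty
  obtain ⟨Q, hQ, hQP⟩ := hbad.infinite_compl.exists_notMem_finset {P}
  rw [Finset.mem_singleton] at hQP
  have hval : ∀ {R : HeightOneSpectrum C}, R ∈ {P : HeightOneSpectrum C | ∃ s : F, (s : K) ∈ S ∧
      s ≠ 0 ∧ P.valuation F s ≠ 1}ᶜ → ∀ s : F, (s : K) ∈ S → s ≠ 0 → R.valuation F s = 1 := by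
    intro R hR s hs hs0
    by_contra h
    exact hR ⟨s, hs, hs0, h⟩
  obtain ⟨x, hxP, hxQ⟩ := heightOneSpectrum_not_le (Ne.symm hQP)
  obtain ⟨u, huQ, huP⟩ := heightOneSpectrum_not_le hQP
  obtain ⟨ϖ, hϖ, hϖQ⟩ : ∃ ϖ : C, P.intValuation ϖ = WithZero.exp (-1 : ℤ) ∧ ϖ ∉ Q.asIdeal := by
    obtain ⟨π, hπ⟩ := P.intValuation_exists_uniformizer
    by_cases h : π ∈ Q.asIdeal
    · refine ⟨π + x ^ 2, ?_, fun h' => ?_⟩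
      · have h2 : P.intValuation (x ^ 2) < P.intValuation π := by
          rw [hπ]
          refine ((P.intValuation_le_pow_iff_mem (x ^ 2) 2).2 (Ideal.pow_mem_pow hxP 2)).trans_lt ?_
          exact WithZero.exp_lt_exp.2 (by norm_num)
        rw [P.intValuation.map_add_eq_of_lt_left h2, hπ]
      · exact hxQ (Q.isPrime.mem_of_pow_mem 2 ((Ideal.add_mem_iff_right _ h).1 h'))
    · exact ⟨π, hπ, h⟩
  obtain ⟨W₀, hW₀⟩ := exists_valuationSubring_extension (K := K) (P.valuation F).valuationSubring
  obtain ⟨W₁, hW₁⟩ := exists_valuationSubring_extension (K := K) (Q.valuation F).valuationSubring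
  have conv : ∀ (R : HeightOneSpectrum C) (W : ValuationSubring K)
      (hW : ∀ f : F, algebraMap F K f ∈ W ↔ f ∈ (R.valuation F).valuationSubring),
      (∀ f : F, W.valuation (f : K) ≤ 1 ↔ R.valuation F f ≤ 1) := by
    intro R W hW f
    rw [W.valuation_le_one_iff]
    exact hW f
  have conv1 : ∀ (R : HeightOneSpectrum C) (W : ValuationSubring K)
      (hW : ∀ f : F, algebraMap F K f ∈ W ↔ f ∈ (R.valuation F).valuationSubring),
      (∀ f : F, W.valuation (f : K) < 1 ↔ R.valuation F f < 1) := by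
    intro R W hW f
    by_cases hf : f = 0
    · simp [hf]
    have h1 := conv R W hW f⁻¹
    have h2 : W.valuation (f : K) ≠ 0 := (Valuation.ne_zero_iff _).2 (by simpa using hf)
    have h3 : R.valuation F f ≠ 0 := (Valuation.ne_zero_iff _).2 hf
    have h4 : ((f⁻¹ : F) : K) = (f : K)⁻¹ := rfl
    rw [h4, map_inv₀, map_inv₀, inv_le_one₀ (zero_lt_iff.2 h2), inv_le_one₀ (zero_lt_iff.2 h3)] at h1
    rw [← not_le, ← not_le, h1]
  have conv2 : ∀ (R : HeightOneSpectrum C) (W : ValuationSubring K)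
      (hW : ∀ f : F, algebraMap F K f ∈ W ↔ f ∈ (R.valuation F).valuationSubring),
      (∀ f : F, W.valuation (f : K) = 1 ↔ R.valuation F f = 1) := by
    intro R W hW f
    have h := (conv1 R W hW f).not
    rw [not_lt, not_lt] at h
    rw [le_antisymm_iff, le_antisymm_iff, conv R W hW, h]
  have hϖ0 : (ϖ : F) ≠ 0 := by
    intro h
    have : ϖ = 0 := Subtype.ext h
    rw [this, map_zero] at hϖ
    exact WithZero.exp_ne_zero hϖ.symm
  have hϖv : P.valuation F (ϖ : F) = WithZero.exp (-1 : ℤ) := by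
    rw [← hϖ]; exact P.valuation_of_algebraMap ϖ
  refine ⟨F.toSubfield, W₀, W₁, (ϖ : F), (u : F), IntermediateField.subset_adjoin F₀ S,
    (ϖ : F).2, (u : F).2, ?_, ?_, ?_, ?_, ?_, by simpa using hϖ0, ?_⟩
  · intro s hs hs0
    let s' : F := ⟨s, IntermediateField.subset_adjoin F₀ S hs⟩
    have hs0' : s' ≠ 0 := fun h => hs0 (congrArg Subtype.val h)
    exact ⟨(conv2 P W₀ hW₀ s').2 (hval hP s' hs hs0'), (conv2 Q W₁ hW₁ s').2 (hval hQ s' hs hs0')⟩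
  · rw [conv1 P W₀ hW₀, hϖv]
    exact WithZero.exp_lt_exp.2 (by norm_num)
  · rw [conv2 Q W₁ hW₁]
    exact Q.valuation_eq_one_iff_notMem.2 hϖQ
  · rw [conv2 P W₀ hW₀]
    exact P.valuation_eq_one_iff_notMem.2 huP
  · rw [conv1 Q W₁ hW₁]
    exact (Q.valuation_lt_one_iff_mem u).2 huQ
  · intro c hc hc0 M n h
    let c' : F := ⟨c, hc⟩
    have hc0' : c' ≠ 0 := fun h => hc0 (congrArg Subtype.val h)
    have h1 : W₀.valuation ((c' ^ M / (ϖ : F) ^ n : F) : K) = 1 := by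
      have : ((c' ^ M / (ϖ : F) ^ n : F) : K) = c ^ M / ((ϖ : F) : K) ^ n := rfl
      rw [this, map_div₀, map_pow, map_pow, h]
      exact div_self (pow_ne_zero _ ((Valuation.ne_zero_iff _).2 (by simpa using hϖ0)))
    rw [conv2 P W₀ hW₀, map_div₀, map_pow, map_pow, hϖv] at h1
    have hcv : P.valuation F c' ≠ 0 := (Valuation.ne_zero_iff _).2 hc0'
    rw [div_eq_one_iff_eq (pow_ne_zero _ WithZero.exp_ne_zero), ← WithZero.exp_log hcv,
      ← WithZero.exp_nsmul, ← WithZero.exp_nsmul, WithZero.exp_inj] at h1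
    have : (n : ℤ) = (M : ℤ) * (- WithZero.log (P.valuation F c')) := by
      simp only [nsmul_eq_mul] at h1
      linarith
    exact Int.natCast_dvd_natCast.1 ⟨_, this⟩

end Specialization

namespace Specialization

open Polynomial IsDedekindDomain

theorem heightOneSpectrum_infinite_of_injective {R ι : Type*} [CommRing R]
    [IsDomain R] [Infinite ι] (f : ι → R) (hf : ∀ i, Prime (f i))
    (hinj : ∀ i j, f i ∣ f j → i = j) : Infinite (HeightOneSpectrum R) := by
  refine Infinite.of_injective (fun i => (⟨Ideal.span {f i},
    (Ideal.span_singleton_prime (hf i).ne_zero).2 (hf i), fun h => (hf i).ne_zero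
      (Ideal.span_singleton_eq_bot.1 h)⟩ : HeightOneSpectrum R)) fun i j h => ?_
  have h := congrArg HeightOneSpectrum.asIdeal h
  simp only at h
  exact hinj i j (Ideal.span_singleton_le_span_singleton.1 h.ge)

instance : Infinite (HeightOneSpectrum ℤ) := by
  refine heightOneSpectrum_infinite_of_injective (fun p : Nat.Primes => ((p : ℕ) : ℤ))
    (fun p => Nat.prime_iff_prime_int.1 p.2) fun p q h => ?_
  exact Subtype.ext ((Nat.prime_dvd_prime_iff_eq p.2 q.2).1 (Int.natCast_dvd_natCast.1 h))

instance (M : Type*) [Field M] [Infinite M] : Infinite (HeightOneSpectrum M[X]) := by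
  refine heightOneSpectrum_infinite_of_injective (fun a : M => (X - C a : M[X]))
    (fun a => prime_X_sub_C a) fun a b h => ?_
  have := (dvd_iff_isRoot.1 h)
  simp only [IsRoot.def, eval_sub, eval_X, eval_C, sub_eq_zero] at this
  exact this

/-- A field of characteristic zero is algebraic over the fraction field of a Dedekind domain
with infinitely many primes, hence carries many pairs of independent valuations. -/
theorem exists_two_valuations {K : Type*} [Field K] [CharZero K] {S : Set K} (hS : S.Finite) :
    ∃ (F : Subfield K) (W₀ W₁ : ValuationSubring K) (ϖ u : K), S ⊆ F ∧ ϖ ∈ F ∧ u ∈ F ∧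
      (∀ s ∈ S, s ≠ 0 → W₀.valuation s = 1 ∧ W₁.valuation s = 1) ∧
      W₀.valuation ϖ < 1 ∧ W₁.valuation ϖ = 1 ∧ W₀.valuation u = 1 ∧ W₁.valuation u < 1 ∧
      ϖ ≠ 0 ∧
      ∀ c ∈ F, c ≠ 0 → ∀ M n : ℕ, W₀.valuation c ^ M = W₀.valuation ϖ ^ n → M ∣ n := by
  obtain ⟨s, hs⟩ := exists_isTranscendenceBasis ℚ K
  rcases s.eq_empty_or_nonempty with rfl | ⟨x, hx⟩
  · have : Algebra.IsAlgebraic ℚ K := hs.isEmpty_iff_isAlgebraic.1 inferInstance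
    exact exists_two_valuations_of_isDedekindDomain (B := ℤ) (F₀ := ℚ) hS
  · have htr := ((AlgebraicIndependent.iff_transcendental_adjoin_image (⟨x, hx⟩ : s)).1 hs.1).2
    set T : Set K := (Subtype.val '' ({⟨x, hx⟩}ᶜ : Set s)) with hT
    let M := IntermediateField.adjoin ℚ T
    have htr' : Transcendental M x := by
      intro halg
      apply htr
      open scoped IntermediateField.algebraAdjoinAdjoin in
      exact (IsFractionRing.isAlgebraic_iff (Algebra.adjoin ℚ T) M K).2 halg
    let : Algebra M[X] K := (aeval x : M[X] →ₐ[M] K).toRingHom.toAlgebra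
    have hinj : Function.Injective (algebraMap M[X] K) :=
      transcendental_iff_injective.1 htr'
    have : FaithfulSMul M[X] K := (faithfulSMul_iff_algebraMap_injective _ _).2 hinj
    have halg := hs.isAlgebraic
    have : Algebra.IsAlgebraic M[X] K := by
      refine ⟨fun z => ?_⟩
      let R₁ := (aeval x : M[X] →ₐ[M] K).range
      have hle : Algebra.adjoin ℚ (Set.range (Subtype.val : s → K)) ≤ R₁.restrictScalars ℚ := by
        refine Algebra.adjoin_le ?_
        rintro _ ⟨y, rfl⟩
        by_cases hy : (y : K) = x
        · exact ⟨X, by simpa using hy.symm⟩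
        · have hyT : (y : K) ∈ T := ⟨y, fun h => hy (congrArg Subtype.val h), rfl⟩
          exact ⟨C ⟨y, IntermediateField.subset_adjoin ℚ T hyT⟩, by simp [IntermediateField.algebraMap_apply]⟩
      have h1 : IsAlgebraic R₁ z := (halg.isAlgebraic z).ringHom_of_comp_eq
        (Subalgebra.inclusion hle).toRingHom (RingHom.id K) (Subalgebra.inclusion_injective hle) rfl
      exact IsAlgebraic.of_ringHom_of_comp_eq (aeval x : M[X] →ₐ[M] K).rangeRestrict.toRingHom
        (RingHom.id K) h1 (AlgHom.rangeRestrict_surjective _) Function.injective_id rfl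
    let := FractionRing.liftAlgebra M[X] K
    have := FractionRing.isScalarTower_liftAlgebra M[X] K
    have : Algebra.IsAlgebraic (FractionRing M[X]) K :=
      (IsFractionRing.comap_isAlgebraic_iff (A := M[X])).1 inferInstance
    have : CharZero (FractionRing M[X]) := (algebraMap (FractionRing M[X]) K).charZero
    exact exists_two_valuations_of_isDedekindDomain (B := M[X]) (F₀ := FractionRing M[X]) hS

end Specialization

namespace Specialization

open Polynomial IsDedekindDomain IntermediateField
open scoped IntermediateField.algebraAdjoinAdjoin

section AffineRing

variable (K : Type*) {L : Type*} [Field K] [Field L] [Algebra K L]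

/-- The integral closure of `K[t]` in `L`, as a `K`-subalgebra. -/
def affineRing (t : L) : Subalgebra K L :=
  (integralClosure (Algebra.adjoin K {t}) L).restrictScalars K

variable {K}

theorem mem_affineRing {t f : L} :
    f ∈ affineRing K t ↔ IsIntegral (Algebra.adjoin K {t}) f := Iff.rfl

theorem self_mem_affineRing (t : L) : t ∈ affineRing K t :=
  isIntegral_algebraMap (R := Algebra.adjoin K {t})
    (x := ⟨t, Algebra.self_mem_adjoin_singleton K t⟩)

instance (t : L) : Algebra (Algebra.adjoin K {t}) (affineRing K t) :=
  inferInstanceAs (Algebra (Algebra.adjoin K {t}) (integralClosure (Algebra.adjoin K {t}) L))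

instance (t : L) : IsScalarTower K (Algebra.adjoin K {t}) (affineRing K t) :=
  IsScalarTower.of_algebraMap_eq fun _ => rfl

instance (t : L) : IsScalarTower (Algebra.adjoin K {t}) (affineRing K t) L :=
  IsScalarTower.of_algebraMap_eq fun _ => rfl

instance (t : L) : IsIntegralClosure (affineRing K t) (Algebra.adjoin K {t}) L :=
  inferInstanceAs (IsIntegralClosure (integralClosure (Algebra.adjoin K {t}) L)
    (Algebra.adjoin K {t}) L)

instance (t : L) : Algebra.IsIntegral (Algebra.adjoin K {t}) (affineRing K t) :=
  IsIntegralClosure.isIntegral_algebra _ L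

theorem isPrincipalIdealRing_adjoin {t : L} (ht : Transcendental K t) :
    IsPrincipalIdealRing (Algebra.adjoin K {t}) :=
  IsPrincipalIdealRing.of_surjective (Polynomial.algEquivOfTranscendental K t ht).toRingEquiv.toRingHom
    (Polynomial.algEquivOfTranscendental K t ht).surjective

instance (t : L) [FiniteDimensional K⟮t⟯ L] : IsFractionRing (affineRing K t) L :=
  IsIntegralClosure.isFractionRing_of_finite_extension (Algebra.adjoin K {t}) K⟮t⟯ L _

variable {t : L} (ht : Transcendental K t) [FiniteDimensional K⟮t⟯ L]

variable [CharZero K]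

include ht in
theorem isDedekindDomain_affineRing : IsDedekindDomain (affineRing K t) := by
  have := isPrincipalIdealRing_adjoin ht
  exact IsIntegralClosure.isDedekindDomain (Algebra.adjoin K {t}) K⟮t⟯ L _

include ht in
theorem finiteType_affineRing : Algebra.FiniteType K (affineRing K t) := by
  have := isPrincipalIdealRing_adjoin ht
  have h : Module.Finite (Algebra.adjoin K {t}) (affineRing K t) :=
    IsIntegralClosure.finite (Algebra.adjoin K {t}) K⟮t⟯ L _
  have : Algebra.FiniteType K (Algebra.adjoin K {t}) := .adjoin_of_finite (Set.finite_singleton t)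
  exact Algebra.FiniteType.trans this inferInstance

end AffineRing

theorem exists_residue_hom {K O : Type*} [Field K] [IsAlgClosed K] [CommRing O] [Algebra K O]
    [Algebra.FiniteType K O] (P : Ideal O) [P.IsMaximal] :
    ∃ ev : O →ₐ[K] K, RingHom.ker ev = P := by
  let := Ideal.Quotient.field P
  have : Module.Finite K (O ⧸ P) := finite_of_finite_type_of_isJacobsonRing K (O ⧸ P)
  let e : K ≃ₐ[K] O ⧸ P := AlgEquiv.ofBijective (Algebra.ofId K (O ⧸ P))
    IsAlgClosed.algebraMap_bijective_of_isIntegral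
  refine ⟨(e.symm : (O ⧸ P) →ₐ[K] K).comp (Ideal.Quotient.mkₐ K P), ?_⟩
  ext x
  simp [RingHom.mem_ker, Ideal.Quotient.eq_zero_iff_mem]

theorem valuation_algebraMap_eq_one {K O L : Type*} [Field K] [CommRing O] [IsDedekindDomain O]
    [Field L] [Algebra O L] [IsFractionRing O L] [Algebra K O] [Algebra K L] [IsScalarTower K O L]
    (P : HeightOneSpectrum O) {c : K} (hc : c ≠ 0) : P.valuation L (algebraMap K L c) = 1 := by
  rw [IsScalarTower.algebraMap_apply K O L, P.valuation_eq_one_iff_notMem]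
  intro h
  exact P.isPrime.ne_top (Ideal.eq_top_of_isUnit_mem _ h ((IsUnit.mk0 c hc).map _))

theorem exists_valuation_sub_lt_one {K O L : Type*} [Field K] [IsAlgClosed K] [CommRing O]
    [IsDedekindDomain O] [Field L] [Algebra O L] [IsFractionRing O L] [Algebra K O] [Algebra K L]
    [IsScalarTower K O L] [Algebra.FiniteType K O] (P : HeightOneSpectrum O) {f : L}
    (hf : P.valuation L f ≤ 1) : ∃ c : K, P.valuation L (f - algebraMap K L c) < 1 := by
  have := P.isMaximal
  obtain ⟨ev, hev⟩ := exists_residue_hom (K := K) P.asIdeal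
  obtain ⟨a, ha⟩ := P.exists_valuation_sub_lt_of_integer hf 1
  refine ⟨ev a, ?_⟩
  have h1 : a - algebraMap K O (ev a) ∈ P.asIdeal := by
    rw [← hev, RingHom.mem_ker]
    simp
  have h2 := (P.valuation_lt_one_iff_mem (K := L) _).2 h1
  change P.valuation L (algebraMap O L _) < 1 at h2
  rw [map_sub, ← IsScalarTower.algebraMap_apply K O L] at h2
  rw [Valuation.map_sub_swap] at ha
  have := Valuation.map_add_lt _ ha h2
  simpa using this

end Specialization

namespace Specialization

open Polynomial IsDedekindDomain IntermediateField
open scoped IntermediateField.algebraAdjoinAdjoin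

section Pole

variable {K L : Type*} [Field K] [Field L] [Algebra K L]

theorem valuation_aeval_of_one_lt {Γ₀ : Type*} [LinearOrderedCommGroupWithZero Γ₀]
    (v : Valuation L Γ₀) (hv : ∀ c : K, c ≠ 0 → v (algebraMap K L c) = 1) {t : L}
    (ht : 1 < v t) {p : K[X]} (hp : p ≠ 0) : v (aeval t p) = v t ^ p.natDegree := by
  rw [← eval_map_algebraMap, valuation_eval_of_one_lt v ht, natDegree_map]
  · intro i
    rw [coeff_map]
    by_cases h : p.coeff i = 0
    · simp [h]
    · exact (hv _ h).le
  · rw [leadingCoeff_map]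
    exact hv _ (leadingCoeff_ne_zero.2 hp)

theorem valuation_algebraMap_of_mem {W : ValuationSubring L} (hW : ∀ c : K, algebraMap K L c ∈ W)
    (c : K) (hc : c ≠ 0) : W.valuation (algebraMap K L c) = 1 := by
  refine le_antisymm ((W.valuation_le_one_iff _).2 (hW c)) ?_
  have := (W.valuation_le_one_iff _).2 (hW c⁻¹)
  rw [map_inv₀, map_inv₀] at this
  exact (inv_le_one₀ (by simp [zero_lt_iff, hc])).1 this

theorem transcendental_of_one_lt {Γ₀ : Type*} [LinearOrderedCommGroupWithZero Γ₀]
    (v : Valuation L Γ₀) (hv : ∀ c : K, c ≠ 0 → v (algebraMap K L c) = 1) {t : L}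
    (ht : 1 < v t) : Transcendental K t := by
  rw [transcendental_iff]
  intro p hp
  by_contra h
  have := valuation_aeval_of_one_lt v hv ht h
  rw [hp, map_zero] at this
  exact pow_ne_zero _ (zero_lt_one.trans ht).ne' this.symm

variable (K) in
/-- The functions regular at all places over `t = ∞`. -/
def poleRing (t : L) : Subalgebra K L where
  carrier := {f | ∀ W : ValuationSubring L, (∀ c : K, algebraMap K L c ∈ W) → t ∉ W → f ∈ W}
  mul_mem' ha hb W h h' := W.mul_mem _ _ (ha W h h') (hb W h h')
  add_mem' ha hb W h h' := W.add_mem _ _ (ha W h h') (hb W h h')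
  algebraMap_mem' c _ h _ := h c

theorem aeval_mem_affineRing (t : L) (p : K[X]) : aeval t p ∈ affineRing K t :=
  Algebra.adjoin_le (S := affineRing K t) (by simpa using self_mem_affineRing t)
    (aeval_mem_adjoin_singleton K t (p := p))

theorem exists_mul_inv_pow_mem_poleRing {t y : L} (hy : y ∈ affineRing K t) :
    ∃ c : ℕ, ∀ n, c ≤ n → y * t⁻¹ ^ n ∈ poleRing K t := by
  obtain ⟨p, hp, hpy⟩ := mem_affineRing.1 hy
  have h1 : ∀ i, ∃ q : K[X], aeval t q = (p.coeff i : L) := fun i => by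
    have := (Algebra.adjoin_singleton_eq_range_aeval K t).le (p.coeff i).2
    simpa using this
  choose q hq using h1
  refine ⟨(Finset.range (p.natDegree + 1)).sup fun i => (q i).natDegree, fun n hn W hK ht => ?_⟩
  rw [← W.valuation_le_one_iff] at ht ⊢
  push Not at ht
  have htn : W.valuation t ≠ 0 := (zero_lt_one.trans ht).ne'
  suffices W.valuation y ≤ W.valuation t ^ n by
    rw [map_mul, map_pow, map_inv₀, inv_pow]
    rwa [← div_eq_mul_inv, div_le_one₀ (pow_pos (zero_lt_iff.2 htn) n)]
  refine valuation_root_le W.valuation (hp.map (algebraMap _ L)) (by simpa [eval_map] using hpy)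
    (one_le_pow₀ ht.le) fun i => ?_
  rw [coeff_map]
  change W.valuation (p.coeff i : L) ≤ _
  by_cases hi : p.natDegree < i
  · simp [coeff_eq_zero_of_natDegree_lt hi]
  by_cases h0 : q i = 0
  · simp [← hq, h0]
  rw [← hq, valuation_aeval_of_one_lt _ (valuation_algebraMap_of_mem hK) ht h0]
  refine pow_le_pow_right₀ ht.le (le_trans ?_ hn)
  exact Finset.le_sup (f := fun i => (q i).natDegree) (by simp; lia)

theorem aeval_div_mem_poleRing (t : L) {p q : K[X]} (h : p.natDegree ≤ q.natDegree) (hq : q ≠ 0) :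
    aeval t p / aeval t q ∈ poleRing K t := by
  intro W hK ht
  rw [← W.valuation_le_one_iff] at ht ⊢
  push Not at ht
  by_cases hp : p = 0
  · simp [hp]
  rw [map_div₀, valuation_aeval_of_one_lt _ (valuation_algebraMap_of_mem hK) ht hp,
    valuation_aeval_of_one_lt _ (valuation_algebraMap_of_mem hK) ht hq]
  rw [div_le_one₀ (pow_pos (zero_lt_one.trans ht) _)]
  exact pow_le_pow_right₀ ht.le h

theorem natDegree_mod_le (p : K[X]) {q : K[X]} (hq : q ≠ 0) : (p % q).natDegree ≤ q.natDegree :=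
  natDegree_le_natDegree (degree_mod_lt p hq).le

theorem natDegree_div_le_of_le {p q : K[X]} (hq : q ≠ 0) {c : ℕ}
    (h : p.natDegree ≤ c + q.natDegree) : (p / q).natDegree ≤ c := by
  by_cases hpq : degree q ≤ degree p
  · have h1 := degree_add_div hq hpq
    have hp : p ≠ 0 := by
      rintro rfl
      rw [degree_zero, le_bot_iff, degree_eq_bot] at hpq
      exact hq hpq
    have hd : p / q ≠ 0 := by
      intro h0
      rw [h0, degree_zero, WithBot.add_bot] at h1
      exact hp (degree_eq_bot.1 h1.symm)
    rw [degree_eq_natDegree hp, degree_eq_natDegree hq, degree_eq_natDegree hd] at h1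
    norm_cast at h1
    lia
  · rw [(Polynomial.div_eq_zero_iff hq).2 (not_le.1 hpq), natDegree_zero]
    exact Nat.zero_le _

theorem exists_decomposition {t : L} (ht : Transcendental K t) {r : L} (hr : r ∈ K⟮t⟯) (c : ℕ) :
    ∃ (h h₂ : K[X]) (ρ : L), h₂.natDegree ≤ c ∧ ρ ∈ poleRing K t ∧
      r = aeval t h + t⁻¹ ^ c * (aeval t h₂ + ρ) := by
  obtain ⟨p, q, rfl⟩ := (mem_adjoin_simple_iff K r).1 hr
  have ht0 : t ≠ 0 := by
    rintro rfl
    exact ht isAlgebraic_zero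
  by_cases hq : q = 0
  · exact ⟨0, 0, 0, by simp, zero_mem _, by simp [hq]⟩
  have hq' : aeval t q ≠ 0 := fun h => hq ((transcendental_iff.1 ht) q h)
  have e1 := congrArg (aeval t) (EuclideanDomain.div_add_mod p q)
  have e2 := congrArg (aeval t) (EuclideanDomain.div_add_mod (X ^ c * (p % q)) q)
  refine ⟨p / q, (X ^ c * (p % q)) / q, aeval t ((X ^ c * (p % q)) % q) / aeval t q, ?_, ?_, ?_⟩
  · refine natDegree_div_le_of_le hq (natDegree_mul_le.trans ?_)
    rw [natDegree_X_pow]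
    exact Nat.add_le_add_left (natDegree_mod_le p hq) c
  · exact aeval_div_mem_poleRing t (natDegree_mod_le _ hq) hq
  · simp only [map_add, map_mul, map_pow, aeval_X] at e1 e2
    rw [inv_pow]
    field_simp
    linear_combination -t ^ c * e1 - e2

end Pole

end Specialization

namespace Specialization

open Polynomial IsDedekindDomain IntermediateField
open scoped IntermediateField.algebraAdjoinAdjoin

section Pole

variable {K L : Type*} [Field K] [Field L] [Algebra K L]

variable {t : L} (ht : Transcendental K t) [FiniteDimensional K⟮t⟯ L]

include ht in
theorem finite_quotient_sup : Module.Finite K (L ⧸ (Subalgebra.toSubmodule (affineRing K t) ⊔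
    Subalgebra.toSubmodule (poleRing K t))) := by
  classical
  have := isPrincipalIdealRing_adjoin ht
  have ht0 : t ≠ 0 := by
    rintro rfl
    exact ht isAlgebraic_zero
  obtain ⟨s, y, hy⟩ := FiniteDimensional.exists_is_basis_integral (Algebra.adjoin K {t}) K⟮t⟯ L
  choose c hc using fun i => exists_mul_inv_pow_mem_poleRing (K := K) (t := t) (y := y i) (hy i)
  let C := Finset.univ.sup c
  have hC : ∀ i, y i * t⁻¹ ^ C ∈ poleRing K t := fun i => hc i C (Finset.le_sup (Finset.mem_univ i))
  let S : Set L := Set.range fun z : s × Fin (C + 1) => t ^ (z.2 : ℕ) * t⁻¹ ^ C * y z.1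
  set N := Subalgebra.toSubmodule (affineRing K t) ⊔ Subalgebra.toSubmodule (poleRing K t) with hN
  have htop : ∀ f : L, f ∈ N ⊔ Submodule.span K S := by
    intro f
    rw [← y.sum_repr f]
    refine Submodule.sum_mem _ fun i _ => ?_
    obtain ⟨h, h₂, ρ, hd, hρ, e⟩ := exists_decomposition ht (y.repr f i).2 C
    rw [IntermediateField.smul_def, e, smul_eq_mul]
    have : (aeval t h + t⁻¹ ^ C * (aeval t h₂ + ρ)) * y i = (aeval t h * y i + ρ * (y i * t⁻¹ ^ C))
      + aeval t h₂ * (t⁻¹ ^ C * y i) := by ring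
    rw [this]
    refine Submodule.add_mem_sup (Submodule.add_mem_sup ?_ ?_) ?_
    · exact (affineRing K t).mul_mem (aeval_mem_affineRing t h) (hy i)
    · exact (poleRing K t).mul_mem hρ (hC i)
    · rw [aeval_eq_sum_range, Finset.sum_mul]
      refine Submodule.sum_mem _ fun j hj => ?_
      rw [smul_mul_assoc, ← mul_assoc]
      refine Submodule.smul_mem _ _ (Submodule.subset_span ?_)
      exact ⟨(i, ⟨j, by simp at hj; lia⟩), rfl⟩
  have hfin : (Submodule.span K S).FG := Submodule.fg_span (Set.finite_range _)
  have : Module.Finite K (Submodule.span K S) := Module.Finite.iff_fg.2 hfin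
  refine Module.Finite.of_surjective (N.mkQ.comp (Submodule.span K S).subtype) ?_
  intro z
  obtain ⟨f, rfl⟩ := N.mkQ_surjective z
  obtain ⟨a, ha, b, hb, rfl⟩ := Submodule.mem_sup.1 (htop f)
  refine ⟨⟨b, hb⟩, ?_⟩
  simp only [LinearMap.comp_apply, Submodule.subtype_apply, map_add, right_eq_add]
  simpa using ha

include ht in
/-- Some polynomial in `f` without constant term splits into a part regular away from
`t = ∞` and a part regular over `t = ∞`. -/
theorem exists_polynomial_split (f : L) : ∃ p : K[X], p ≠ 0 ∧ ∃ a ∈ affineRing K t,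
    ∃ b ∈ poleRing K t, aeval f (X * p) = a + b := by
  have := finite_quotient_sup ht
  set N := Subalgebra.toSubmodule (affineRing K t) ⊔ Subalgebra.toSubmodule (poleRing K t) with hN
  let g : K[X] →ₗ[K] L ⧸ N := N.mkQ ∘ₗ (aeval f).toLinearMap ∘ₗ LinearMap.mulLeft K X
  have hg : ¬ Function.Injective g := fun h =>
    Polynomial.not_finite (R := K) (Module.Finite.of_injective g h)
  rw [injective_iff_map_eq_zero] at hg
  push Not at hg
  obtain ⟨p, hp, hp0⟩ := hg
  have hm : aeval f (X * p) ∈ N := by simpa [g] using hp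
  obtain ⟨a, ha, b, hb, e⟩ := Submodule.mem_sup.1 hm
  exact ⟨p, hp0, a, ha, b, hb, e.symm⟩

omit [FiniteDimensional K⟮t⟯ L] in
include ht in
theorem not_isField_affineRing : ¬ IsField (affineRing K t) := by
  intro h
  have h1 := isField_of_isIntegral_of_isField (R := Algebra.adjoin K {t}) (S := affineRing K t)
    (fun a b hab => Subtype.ext (congrArg (fun z : affineRing K t => (z : L)) hab)) h
  exact Polynomial.not_isField K
    ((Polynomial.algEquivOfTranscendental K t ht).toMulEquiv.isField h1)

end Pole

/-- An element with a pole at `Q` and nowhere else. -/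
theorem exists_single_pole {O L : Type*} [CommRing O] [IsDedekindDomain O] [Field L] [Algebra O L]
    [IsFractionRing O L] (Q : HeightOneSpectrum O) : ∃ f : L, 1 < Q.valuation L f ∧
    ∀ x ∈ Q.asIdeal, ∃ z : O, algebraMap O L z = algebraMap O L x * f := by
  have h0 : (Q.asIdeal : FractionalIdeal (nonZeroDivisors O) L) ≠ 0 :=
    FractionalIdeal.coeIdeal_ne_zero.2 Q.ne_bot
  obtain ⟨f, hf, hf1⟩ := FractionalIdeal.exists_notMem_one_of_ne_bot Q.ne_bot Q.isPrime.ne_top (K := L)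
  have hmul : ∀ x ∈ Q.asIdeal, ∃ z : O, algebraMap O L z = algebraMap O L x * f := by
    intro x hx
    have := (FractionalIdeal.mem_inv_iff h0).1 hf _ (FractionalIdeal.mem_coeIdeal_of_mem _ hx)
    obtain ⟨z, hz⟩ := (FractionalIdeal.mem_one_iff _).1 this
    exact ⟨z, by rw [hz, mul_comm]⟩
  refine ⟨f, ?_, hmul⟩
  by_contra! hle
  apply hf1
  rw [FractionalIdeal.mem_one_iff]
  suffices f ∈ (algebraMap O L).range by simpa using this
  refine HeightOneSpectrum.mem_integers_of_valuation_le_one L f fun P => ?_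
  by_cases hP : P = Q
  · rwa [hP]
  obtain ⟨x, hx, hxP⟩ := heightOneSpectrum_not_le (Ne.symm hP)
  obtain ⟨z, hz⟩ := hmul x hx
  have h1 : P.valuation L (algebraMap O L x) = 1 := P.valuation_eq_one_iff_notMem.2 hxP
  have h2 : P.valuation L (algebraMap O L z) ≤ 1 := P.valuation_le_one z
  rwa [hz, map_mul, h1, one_mul] at h2

end Specialization

namespace Specialization

open Polynomial IsDedekindDomain IntermediateField
open scoped IntermediateField.algebraAdjoinAdjoin

section UniquePole

variable {K L : Type*} [Field K] [Field L] [Algebra K L]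

theorem finiteDimensional_adjoin_of_transcendental {t b : L} (ht : Transcendental K t)
    [FiniteDimensional K⟮t⟯ L] (hb : Transcendental K b) : FiniteDimensional K⟮b⟯ L := by
  have hti : AlgebraicIndependent K (fun _ : Unit => t) :=
    algebraicIndependent_unique_type_iff.2 ht
  have hbi : AlgebraicIndependent K (fun _ : Unit => b) :=
    algebraicIndependent_unique_type_iff.2 hb
  have htb : IsTranscendenceBasis K (fun _ : Unit => t) := by
    rw [hti.isTranscendenceBasis_iff_isAlgebraic]
    rw [Set.range_const]
    rw [IsFractionRing.comap_isAlgebraic_iff (K := K⟮t⟯)]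
    infer_instance
  have hbb : IsTranscendenceBasis K (fun _ : Unit => b) := by
    refine hbi.isTranscendenceBasis_of_lift_trdeg_le_of_finite ?_
    rw [← htb.lift_cardinalMk_eq_trdeg]
  have halg := hbb.isAlgebraic_field
  rw [Set.range_const] at halg
  have h1 : Algebra.EssFiniteType K L := by
    have : Algebra.EssFiniteType K K⟮t⟯ := by
      rw [IntermediateField.essFiniteType_iff]
      exact ⟨{t}, by simp⟩
    exact Algebra.EssFiniteType.comp K K⟮t⟯ L
  have h2 : Algebra.EssFiniteType K⟮b⟯ L := Algebra.EssFiniteType.of_comp K K⟮b⟯ L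
  exact Algebra.finite_of_essFiniteType_of_isAlgebraic

variable [IsAlgClosed K]

theorem mem_range_of_forall_mem_valuationSubring {f : L}
    (h : ∀ W : ValuationSubring L, (∀ c : K, algebraMap K L c ∈ W) → f ∈ W) :
    ∃ c : K, algebraMap K L c = f := by
  have h1 : f ∈ (⨅ V : {V : ValuationSubring L // (Set.range (algebraMap K L)) ⊆ V.toSubring},
      V.1.toSubring) := by
    simp only [Subring.mem_iInf]
    exact fun V => h V.1 fun c => V.2 ⟨c, rfl⟩
  rw [iInf_valuationSubring_superset] at h1
  have h2 : IsIntegral (Subring.closure (Set.range (algebraMap K L))) f := h1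
  have h3 : IsIntegral K f := by
    obtain ⟨p, hp, hpf⟩ := h2
    have h4 : Subring.closure (Set.range (algebraMap K L)) ≤ (algebraMap K L).range := by
      rw [Subring.closure_le]
      rintro _ ⟨c, rfl⟩
      exact ⟨c, rfl⟩
    have h5 : p.map (algebraMap _ L) ∈ Polynomial.lifts (algebraMap K L) := by
      rw [Polynomial.lifts_iff_coeff_lifts]
      intro n
      rw [coeff_map]
      exact h4 (p.coeff n).2
    obtain ⟨q, hq, -, hqm⟩ := Polynomial.lifts_and_natDegree_eq_and_monic h5 (hp.map _)
    refine ⟨q, hqm, ?_⟩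
    rw [← eval_map, hq, eval_map, hpf]
  have : FiniteDimensional K K⟮f⟯ := adjoin.finiteDimensional h3
  obtain ⟨c, hc⟩ := IsAlgClosed.algebraMap_bijective_of_isIntegral
    (k := K) (K := K⟮f⟯) |>.2 ⟨f, mem_adjoin_simple_self K f⟩
  exact ⟨c, congrArg Subtype.val hc⟩

omit [IsAlgClosed K] in
theorem aeval_mem_valuationSubring {W : ValuationSubring L}
    (hW : ∀ c : K, algebraMap K L c ∈ W) {z : L} (hz : z ∈ W) (p : K[X]) : aeval z p ∈ W := by
  rw [aeval_eq_sum_range]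
  refine sum_mem fun i _ => ?_
  rw [Algebra.smul_def]
  exact mul_mem (hW _) (pow_mem hz _)

omit [IsAlgClosed K] in
theorem mem_valuationSubring_of_mem_affineRing {W : ValuationSubring L}
    (hW : ∀ c : K, algebraMap K L c ∈ W) {y z : L} (hy : y ∈ affineRing K z) (hz : z ∈ W) :
    y ∈ W := by
  obtain ⟨p, hp, hpy⟩ := mem_affineRing.1 hy
  rw [← W.valuation_le_one_iff]
  refine valuation_root_le W.valuation (hp.map (algebraMap _ L)) (by simpa [eval_map] using hpy)
    le_rfl fun i => ?_
  rw [coeff_map, W.valuation_le_one_iff]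
  obtain ⟨q, hq⟩ := (Algebra.adjoin_singleton_eq_range_aeval K z).le (p.coeff i).2
  change (p.coeff i : L) ∈ W
  rw [← hq]
  exact aeval_mem_valuationSubring hW hz q

variable [CharZero K]

theorem exists_unique_pole {t : L} (ht : Transcendental K t) [FiniteDimensional K⟮t⟯ L] :
    ∃ (b : L) (v : Valuation L (WithZero (Multiplicative ℤ))),
      (∀ c : K, c ≠ 0 → v (algebraMap K L c) = 1) ∧ 1 < v b ∧
      (∀ f, v f ≤ 1 → ∃ c : K, v (f - algebraMap K L c) < 1) ∧
      (∀ f ∈ affineRing K b, v f ≤ 1 → ∃ c : K, algebraMap K L c = f) := by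
  have := isDedekindDomain_affineRing (L := L) ht
  have := finiteType_affineRing (L := L) ht
  obtain ⟨M, hM⟩ := Ideal.exists_maximal (affineRing K t)
  let Q : HeightOneSpectrum (affineRing K t) :=
    ⟨M, hM.isPrime, fun h => not_isField_affineRing ht
      (Ring.isField_iff_maximal_bot.2 (h ▸ hM))⟩
  obtain ⟨f₁, hf₁, hmul⟩ := exists_single_pole (L := L) Q
  have hv : ∀ c : K, c ≠ 0 → Q.valuation L (algebraMap K L c) = 1 :=
    fun c hc => valuation_algebraMap_eq_one Q hc
  obtain ⟨p, hp, a, ha, b, hb, e⟩ := exists_polynomial_split ht f₁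
  have h1 : 1 < Q.valuation L (aeval f₁ (X * p)) := by
    rw [valuation_aeval_of_one_lt _ hv hf₁ (mul_ne_zero X_ne_zero hp)]
    refine one_lt_pow₀ hf₁ ?_
    rw [natDegree_X_mul hp]
    exact Nat.succ_ne_zero _
  have hva : Q.valuation L a ≤ 1 := Q.valuation_le_one (⟨a, ha⟩ : affineRing K t)
  have hvb : 1 < Q.valuation L b := by
    by_contra! h
    rw [e] at h1
    exact h1.not_ge (Valuation.map_add_le _ hva h)
  refine ⟨b, Q.valuation L, hv, hvb, fun f hf => exists_valuation_sub_lt_one Q hf,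
    fun f hf hvf => mem_range_of_forall_mem_valuationSubring fun W hW => ?_⟩
  by_cases ht : t ∈ W
  · have hO : ∀ y ∈ affineRing K t, y ∈ W :=
      fun y hy => mem_valuationSubring_of_mem_affineRing hW hy ht
    by_cases h₁ : f₁ ∈ W
    · refine mem_valuationSubring_of_mem_affineRing hW hf ?_
      rw [← sub_eq_of_eq_add' e]
      exact sub_mem (aeval_mem_valuationSubring hW h₁ _) (hO a ha)
    · have hO' : ∀ y : affineRing K t, W.valuation (y : L) ≤ 1 :=
        fun y => (W.valuation_le_one_iff _).2 (hO y y.2)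
      rw [← W.valuation_le_one_iff] at h₁
      push Not at h₁
      have hlt : ∀ x ∈ M, W.valuation (x : L) < 1 := by
        intro x hx
        obtain ⟨z, hz⟩ := hmul x hx
        have h2 := hO' z
        change (z : L) = x * f₁ at hz
        rw [hz, map_mul] at h2
        by_contra! h3
        exact (lt_of_lt_of_le h₁ (le_mul_of_one_le_left' h3)).not_ge h2
      have hone : ∀ d : affineRing K t, d ∉ M → W.valuation (d : L) = 1 := by
        intro d hd
        obtain ⟨y, i, hi, hyi⟩ := hM.exists_inv hd
        refine le_antisymm (hO' d) ?_
        have h2 : (1 : L) - i = y * d := by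
          rw [sub_eq_iff_eq_add, ← Subalgebra.coe_mul, ← Subalgebra.coe_add, hyi,
            Subalgebra.coe_one]
        have h3 : W.valuation (1 - (i : L)) = 1 := by
          rw [W.valuation.map_one_sub_of_lt (hlt i hi)]
        rw [h2, map_mul] at h3
        rw [← h3]
        exact mul_le_of_le_one_left' (hO' y)
      obtain ⟨n, d, hnd⟩ := Q.exists_primeCompl_mul_eq_of_integer f hvf
      have h2 : f * (d.1 : L) = (n : L) := hnd
      have h3 := hO' n
      rw [← h2, map_mul, hone d.1 d.2, mul_one] at h3
      exact (W.valuation_le_one_iff f).1 h3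
  · exact mem_valuationSubring_of_mem_affineRing hW hf (hb W hW ht)

end UniquePole

end Specialization

namespace Specialization

open Polynomial IsDedekindDomain IntermediateField

section AperyBasis

variable {K L : Type*} [Field K] [Field L] [Algebra K L]

open WithZero

/-- The affine algebra `K[b]`-integral functions, filtered by the pole order at the unique
place at infinity, has a basis with pairwise incongruent pole orders. -/
theorem exists_graded_generators {b : L} {v : Valuation L (WithZero (Multiplicative ℤ))}
    (hv : ∀ c : K, c ≠ 0 → v (algebraMap K L c) = 1) (hb : 1 < v b)
    (hres : ∀ f, v f ≤ 1 → ∃ c : K, v (f - algebraMap K L c) < 1)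
    (hconst : ∀ f ∈ affineRing K b, v f ≤ 1 → ∃ c : K, algebraMap K L c = f) :
    ∃ (m : ℕ) (ι : Type) (_ : Fintype ι) (y : ι → L) (d : ι → ℕ), 0 < m ∧ v b = exp (m : ℤ) ∧
      (∀ i, y i ∈ affineRing K b) ∧ (∀ i, v (y i) = exp (d i : ℤ)) ∧
      (∀ i j, d i % m = d j % m → i = j) ∧
      ∀ D : ℕ, ∀ f ∈ affineRing K b, v f < exp (D : ℤ) → ∃ p : ι → K[X],
        f = ∑ i, aeval b (p i) * y i ∧ ∀ i k, (p i).coeff k ≠ 0 → m * k + d i < D := by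
  classical
  have hb0 : v b ≠ 0 := (zero_lt_one.trans hb).ne'
  have hdeg : ∀ f ∈ affineRing K b, f ≠ 0 → ∃ n : ℕ, v f = exp (n : ℤ) := by
    intro f hf hf0
    have h0 : v f ≠ 0 := (Valuation.ne_zero_iff v).2 hf0
    have h1 : 1 ≤ v f := by
      by_contra! h
      obtain ⟨c, rfl⟩ := hconst f hf h.le
      have hc : c ≠ 0 := by
        rintro rfl
        exact hf0 (map_zero _)
      exact h.ne (hv c hc)
    refine ⟨(log (v f)).toNat, ?_⟩
    have h2 : 0 ≤ log (v f) := by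
      rw [← exp_log h0, ← exp_zero, exp_le_exp] at h1
      exact h1
    rw [Int.toNat_of_nonneg h2, exp_log h0]
  obtain ⟨m, hm⟩ := hdeg b (self_mem_affineRing b) (by rintro rfl; simp at hb0)
  have hm0 : 0 < m := by
    rw [hm, ← exp_zero, exp_lt_exp] at hb
    exact_mod_cast hb
  let P : Fin m → ℕ → Prop := fun r n => n % m = r ∧ ∃ f ∈ affineRing K b, v f = exp (n : ℤ)
  let ι := {r : Fin m // ∃ n, P r n}
  let d : ι → ℕ := fun i => Nat.find i.2
  have hd : ∀ i, P i.1 (d i) := fun i => Nat.find_spec i.2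
  choose y hy hvy using fun i => (hd i).2
  refine ⟨m, ι, inferInstance, y, d, hm0, hm, hy, hvy, ?_, ?_⟩
  · intro i j hij
    rw [(hd i).1, (hd j).1] at hij
    exact Subtype.ext (Fin.ext hij)
  intro D
  induction D using Nat.strong_induction_on with
  | _ D ih =>
  intro f hf hfD
  by_cases hf0 : f = 0
  · exact ⟨0, by simp [hf0], by simp⟩
  obtain ⟨n, hn⟩ := hdeg f hf hf0
  have hnD : n < D := by
    rw [hn, exp_lt_exp] at hfD
    exact_mod_cast hfD
  let i : ι := ⟨⟨n % m, Nat.mod_lt n hm0⟩, n, rfl, f, hf, hn⟩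
  have hdi : d i ≤ n := Nat.find_min' i.2 ⟨rfl, f, hf, hn⟩
  have hmod : d i % m = n % m := (hd i).1
  obtain ⟨j, hj⟩ : ∃ j, n = m * j + d i := by
    obtain ⟨j, hj⟩ := (Nat.modEq_iff_dvd' hdi).1 hmod
    exact ⟨j, by lia⟩
  have hg : v (b ^ j * y i) = exp (n : ℤ) := by
    rw [map_mul, map_pow, hm, hvy, ← exp_nsmul, ← exp_add, hj]
    congr 1
    push_cast
    rw [nsmul_eq_mul, mul_comm]
  have hg0 : b ^ j * y i ≠ 0 := by
    intro h
    rw [h, map_zero] at hg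
    exact exp_ne_zero hg.symm
  obtain ⟨c, hc⟩ := hres (f / (b ^ j * y i)) (by
    rw [map_div₀, hn, hg, div_self exp_ne_zero])
  have hlt : v (f - algebraMap K L c * (b ^ j * y i)) < exp (n : ℤ) := by
    have : f - algebraMap K L c * (b ^ j * y i) =
      (f / (b ^ j * y i) - algebraMap K L c) * (b ^ j * y i) := by
      rw [sub_mul, div_mul_cancel₀ _ hg0]
    rw [this, map_mul, hg]
    exact mul_lt_of_lt_one_left (zero_lt_iff.2 exp_ne_zero) hc
  have hmem : f - algebraMap K L c * (b ^ j * y i) ∈ affineRing K b :=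
    sub_mem hf (mul_mem (Subalgebra.algebraMap_mem _ _)
      (mul_mem (pow_mem (self_mem_affineRing b) _) (hy i)))
  obtain ⟨p, hp, hpd⟩ := ih n hnD _ hmem hlt
  refine ⟨fun l => p l + if l = i then monomial j c else 0, ?_, ?_⟩
  · simp only [map_add, add_mul, Finset.sum_add_distrib, ← hp]
    rw [Finset.sum_eq_single i (by intro l _ hl; simp [hl]) (by simp)]
    simp [aeval_monomial]
    ring
  · intro l k hlk
    rw [coeff_add] at hlk
    by_cases h : (p l).coeff k = 0
    · rw [h, zero_add] at hlk
      split_ifs at hlk with hl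
      · rw [coeff_monomial] at hlk
        split_ifs at hlk with hjk
        · subst hl hjk
          lia
        · exact absurd rfl hlk
      · simp at hlk
    · exact (hpd l k h).trans hnD

end AperyBasis

end Specialization

namespace Specialization

open Polynomial

section Size

variable {K Γ₀ : Type*} [Field K] [LinearOrderedCommGroupWithZero Γ₀]

theorem valuation_tail_lt (w : Valuation K Γ₀) {τ : K} {m : ℕ} (hτ : 1 < w τ)
    {ι : Type*} [Fintype ι] {Y : ι → K} {d : ι → ℕ} {p : ι → K[X]} {N : ℕ}
    (hp : ∀ j k, w ((p j).coeff k) ≤ 1) (hd : ∀ j k, (p j).coeff k ≠ 0 → m * k + d j < N)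
    {Θ : Γ₀} (hΘ : 1 ≤ Θ) (hY : ∀ j, w (Y j) ≤ w τ ^ d j * Θ) :
    w (∑ j, (p j).eval (τ ^ m) * Y j) < w τ ^ N * Θ := by
  have hτ0 : 0 < w τ := zero_lt_one.trans hτ
  have hΘ0 : 0 < Θ := zero_lt_one.trans_le hΘ
  refine w.map_sum_lt (mul_pos (pow_pos hτ0 N) hΘ0).ne' fun j _ => ?_
  rw [eval_eq_sum_range, Finset.sum_mul]
  refine w.map_sum_lt (mul_pos (pow_pos hτ0 N) hΘ0).ne' fun k _ => ?_
  by_cases h : (p j).coeff k = 0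
  · simpa [h] using mul_pos (pow_pos hτ0 N) hΘ0
  rw [map_mul, map_mul, ← pow_mul, map_pow, mul_assoc]
  calc w ((p j).coeff k) * (w τ ^ (m * k) * w (Y j)) ≤ 1 * (w τ ^ (m * k) * (w τ ^ d j * Θ)) :=
        mul_le_mul' (hp j k) (mul_le_mul' le_rfl (hY j))
    _ = w τ ^ (m * k + d j) * Θ := by rw [one_mul, pow_add, mul_assoc]
    _ < w τ ^ N * Θ := mul_lt_mul_of_pos_right (pow_lt_pow_right₀ hτ (hd j k h)) hΘ0

theorem valuation_eq_pow_of_relations (w : Valuation K Γ₀) {τ : K} {m : ℕ} (hm : m ≠ 0)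
    (hτ : 1 < w τ) {ι : Type*} [Fintype ι] {Y : ι → K} {d : ι → ℕ} {c : ι → K}
    {p : ι → ι → K[X]} (hc : ∀ i, w (c i) = 1) (hp : ∀ i j k, w ((p i j).coeff k) ≤ 1)
    (hd : ∀ i j k, (p i j).coeff k ≠ 0 → m * k + d j < m * d i)
    (hY : ∀ i, Y i ^ m = c i * (τ ^ m) ^ d i + ∑ j, (p i j).eval (τ ^ m) * Y j) (i : ι) :
    w (Y i) = w τ ^ d i := by
  have hτ0 : 0 < w τ := zero_lt_one.trans hτ
  have hlead : ∀ i, w (c i * (τ ^ m) ^ d i) = w τ ^ (m * d i) := fun i => by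
    rw [map_mul, hc, one_mul, ← pow_mul, map_pow]
  have hle : ∀ j, w (Y j) ≤ w τ ^ d j * 1 := by
    let θ : ι → Γ₀ := fun j => w (Y j) / w τ ^ d j
    have hθ : ∀ j, w (Y j) = w τ ^ d j * θ j := fun j =>
      (mul_div_cancel₀ _ (pow_pos hτ0 _).ne').symm
    by_contra! hcon
    obtain ⟨j₀, hj₀⟩ := hcon
    obtain ⟨j, -, hj⟩ := Finset.univ.exists_max_image θ ⟨j₀, Finset.mem_univ _⟩
    have h1 : 1 < θ j := by
      refine lt_of_lt_of_le ?_ (hj j₀ (Finset.mem_univ _))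
      rw [hθ j₀] at hj₀
      exact lt_of_mul_lt_mul_left hj₀ zero_le
    have h2 := valuation_tail_lt w hτ (hp j) (hd j) h1.le
      (fun l => (hθ l).le.trans (mul_le_mul' le_rfl (hj l (Finset.mem_univ _))))
    have h3 : w (c j * (τ ^ m) ^ d j) < w τ ^ (m * d j) * θ j := by
      rw [hlead]
      exact lt_mul_of_one_lt_right (pow_pos hτ0 _) h1
    have h4 := w.map_add_lt h3 h2
    rw [← hY, map_pow, hθ, mul_pow, ← pow_mul, mul_comm (d j) m] at h4
    exact (lt_of_mul_lt_mul_left h4 zero_le).not_ge (le_self_pow₀ h1.le hm)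
  have h2 := valuation_tail_lt w hτ (hp i) (hd i) le_rfl hle
  rw [mul_one, ← hlead] at h2
  have h3 := w.map_add_eq_of_lt_left h2
  rw [← hY, hlead, map_pow, mul_comm m, pow_mul] at h3
  exact (pow_left_inj₀ zero_le zero_le hm).1 h3

/-- Independence of the monomials `t₀ ^ k * Y i`, `k < q`, over a subfield whose value group meets
that of `τ` only in multiples of `m * q`. -/
theorem eq_zero_of_sum_eval_eq_zero (w : Valuation K Γ₀) {F : Subfield K} {ϖ τ : K} {m q : ℕ}
    (hm : m ≠ 0) (hτ : 1 < w τ) (hϖ : w (τ ^ m) ^ q * w ϖ = 1)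
    (hF : ∀ c ∈ F, c ≠ 0 → ∀ M n : ℕ, w c ^ M = w ϖ ^ n → M ∣ n)
    {ι : Type*} [Fintype ι] {Y : ι → K} {d : ι → ℕ} (hd : ∀ i j, d i % m = d j % m → i = j)
    (hY : ∀ i, w (Y i) = w τ ^ d i) {p : ι → K[X]} (hpF : ∀ i k, (p i).coeff k ∈ F)
    (hpq : ∀ i, (p i).degree < q) (h : ∑ i, (p i).eval (τ ^ m) * Y i = 0) : ∀ i, p i = 0 := by
  have hτ0 : 0 < w τ := zero_lt_one.trans hτ
  let a : ι × Fin q → K := fun z => (p z.1).coeff z.2 * (τ ^ m) ^ (z.2 : ℕ) * Y z.1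
  have hsum : ∑ z, a z = 0 := by
    rw [← h, Fintype.sum_prod_type]
    refine Finset.sum_congr rfl fun i _ => ?_
    have : (p i).eval (τ ^ m) = ∑ k : Fin q, (p i).coeff k * (τ ^ m) ^ (k : ℕ) := by
      rw [eval_eq_sum, sum_fin (fun k c => c * (τ ^ m) ^ k) (by simp) (hpq i)]
    rw [this, Finset.sum_mul]
  have hval : ∀ z, w (a z) = w ((p z.1).coeff z.2) * w τ ^ (m * z.2 + d z.1) := fun z => by
    simp only [a]
    rw [map_mul, map_mul, hY, ← pow_mul, map_pow, pow_add, mul_assoc]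
  have hcoeff : ∀ z, a z ≠ 0 → (p z.1).coeff z.2 ≠ 0 := fun z hz h0 => hz (by simp [a, h0])
  have hwϖ : ∀ n : ℕ, w τ ^ (m * q * n) * w ϖ ^ n = 1 := fun n => by
    rw [pow_mul, pow_mul, ← mul_pow, ← map_pow, hϖ, one_pow]
  have key : ∀ z z' : ι × Fin q, a z ≠ 0 → a z' ≠ 0 → w (a z) = w (a z') →
      m * z.2 + d z.1 ≤ m * z'.2 + d z'.1 → z = z' := by
    intro z z' hz hz' heq hle
    obtain ⟨n, hn⟩ := Nat.exists_eq_add_of_le hle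
    rw [hval, hval, hn, pow_add (w τ) _ n, mul_comm (w τ ^ _) (w τ ^ n), ← mul_assoc] at heq
    have h1 := mul_right_cancel₀ (pow_pos hτ0 _).ne' heq
    have h2 : (m * q) ∣ n := by
      refine hF ((p z'.1).coeff z'.2 / (p z.1).coeff z.2) (div_mem (hpF _ _) (hpF _ _))
        (div_ne_zero (hcoeff _ hz') (hcoeff _ hz)) (m * q) n ?_
      have h0 : w ((p z'.1).coeff z'.2) ≠ 0 := (w.ne_zero_iff).2 (hcoeff _ hz')
      rw [map_div₀, h1, ← div_div, div_self h0, one_div, inv_pow, ← pow_mul,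
        mul_comm n]
      exact (eq_inv_of_mul_eq_one_right (hwϖ n)).symm
    have h3 : z.1 = z'.1 := by
      refine hd _ _ ?_
      have h4 : m ∣ n := (Dvd.intro _ rfl).trans h2
      obtain ⟨e, rfl⟩ := h4
      have := congrArg (· % m) hn
      simp only [Nat.mul_add_mod, Nat.add_mul_mod_self_left] at this
      exact this.symm
    rw [h3] at hn
    obtain ⟨e, rfl⟩ := h2
    have h5 : (z'.2 : ℕ) = z.2 + q * e := by
      have : m * (z'.2 : ℕ) = m * (z.2 + q * e) := by
        rw [mul_add, ← mul_assoc]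
        lia
      exact Nat.eq_of_mul_eq_mul_left (Nat.pos_of_ne_zero hm) this
    have h6 : (z.2 : ℕ) = z'.2 := by
      rcases Nat.eq_zero_or_pos e with rfl | he
      · simpa using h5.symm
      · have := Nat.le_mul_of_pos_right q he
        have := z'.2.2
        lia
    exact Prod.ext h3 (Fin.ext h6)
  have hzero := eq_zero_of_sum_eq_zero_of_valuation_ne w Finset.univ a
    (fun z _ z' _ hz hz' heq => (le_total _ _).elim (key z z' hz hz' heq)
      fun hle => (key z' z hz' hz heq.symm hle).symm) hsum
  intro i
  ext k
  rw [coeff_zero]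
  by_cases hk : k < q
  · have h1 := hzero (i, ⟨k, hk⟩) (Finset.mem_univ _)
    by_contra h0
    have h2 := hval (i, ⟨k, hk⟩)
    rw [h1, map_zero] at h2
    exact mul_ne_zero (w.ne_zero_iff.2 h0) (pow_pos hτ0 _).ne' h2.symm
  · exact coeff_eq_zero_of_degree_lt ((hpq i).trans_le (by exact_mod_cast not_lt.1 hk))

end Size

end Specialization

namespace Specialization

open Polynomial

section CoordinateRing

variable {K O ι : Type*} [Field K] [CommRing O] [Algebra K O] [Fintype ι]

/-- The combinations of the `y i` with coefficients in `R[b]`. -/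
def coordGroup (R : Subring K) (b : O) (y : ι → O) : AddSubgroup O where
  carrier := {f | ∃ p : ι → K[X], (∀ i, p i ∈ liftsRing R.subtype) ∧
    f = ∑ i, aeval b (p i) * y i}
  zero_mem' := ⟨0, fun _ => zero_mem _, by simp⟩
  add_mem' := by
    rintro _ _ ⟨p, hp, rfl⟩ ⟨r, hr, rfl⟩
    exact ⟨p + r, fun i => add_mem (hp i) (hr i), by simp [add_mul, Finset.sum_add_distrib]⟩
  neg_mem' := by
    rintro _ ⟨p, hp, rfl⟩
    exact ⟨-p, fun i => neg_mem (hp i), by simp⟩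

variable {R : Subring K} {b : O} {y : ι → O}

theorem aeval_mul_mem_coordGroup {r : K[X]} (hr : r ∈ liftsRing R.subtype) {f : O}
    (hf : f ∈ coordGroup R b y) : aeval b r * f ∈ coordGroup R b y := by
  obtain ⟨p, hp, rfl⟩ := hf
  exact ⟨fun i => r * p i, fun i => mul_mem hr (hp i), by simp [Finset.mul_sum, mul_assoc]⟩

theorem mul_mem_coordGroup (hmul : ∀ i j, y i * y j ∈ coordGroup R b y) {f g : O}
    (hf : f ∈ coordGroup R b y) (hg : g ∈ coordGroup R b y) : f * g ∈ coordGroup R b y := by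
  obtain ⟨p, hp, rfl⟩ := hf
  obtain ⟨r, hr, rfl⟩ := hg
  rw [Finset.sum_mul_sum]
  refine sum_mem fun i _ => sum_mem fun j _ => ?_
  rw [mul_mul_mul_comm, ← map_mul]
  exact aeval_mul_mem_coordGroup (mul_mem (hp i) (hr j)) (hmul i j)

/-- The ring of combinations of the `y i` with coefficients in `R[b]`. -/
def coordRing (h1 : 1 ∈ coordGroup R b y) (hmul : ∀ i j, y i * y j ∈ coordGroup R b y) :
    Subring O where
  __ := coordGroup R b y
  one_mem' := h1
  mul_mem' := mul_mem_coordGroup hmul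

theorem C_mem_liftsRing {c : K} (hc : c ∈ R) : C c ∈ liftsRing R.subtype :=
  ⟨C ⟨c, hc⟩, by simp⟩

theorem mem_liftsRing_iff {p : K[X]} : p ∈ liftsRing R.subtype ↔ ∀ k, p.coeff k ∈ R := by
  rw [← lifts_iff_liftsRing, lifts_iff_coeff_lifts]
  simp

theorem algebraMap_mem_coordGroup (h1 : 1 ∈ coordGroup R b y) {c : K} (hc : c ∈ R) :
    algebraMap K O c ∈ coordGroup R b y := by
  simpa using aeval_mul_mem_coordGroup (C_mem_liftsRing hc) h1

theorem divByMonic_mem_liftsRing {p μ : K[X]} (hp : p ∈ liftsRing R.subtype) (hμ : μ.Monic)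
    (hμ' : μ ∈ liftsRing R.subtype) :
    p /ₘ μ ∈ liftsRing R.subtype ∧ p %ₘ μ ∈ liftsRing R.subtype := by
  obtain ⟨p, rfl⟩ := hp
  obtain ⟨ν, rfl⟩ := hμ'
  simp only [coe_mapRingHom] at hμ ⊢
  have hν : ν.Monic := Function.Injective.monic_map_iff R.subtype_injective |>.2 hμ
  rw [← map_divByMonic _ hν, ← map_modByMonic _ hν]
  exact ⟨⟨_, rfl⟩, ⟨_, rfl⟩⟩

theorem evaluation_mem {ev : O →ₐ[K] K} (hb : ev b ∈ R) (hy : ∀ i, ev (y i) ∈ R) {f : O}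
    (hf : f ∈ coordGroup R b y) : ev f ∈ R := by
  obtain ⟨p, hp, rfl⟩ := hf
  rw [map_sum]
  refine sum_mem fun i _ => ?_
  rw [map_mul, ← aeval_algHom_apply, aeval_eq_sum_range]
  refine mul_mem (sum_mem fun k _ => ?_) (hy i)
  exact mul_mem (mem_liftsRing_iff.1 (hp i) k) (pow_mem hb k)

/-- Elements of the coordinate ring killed by a specialization at a root of `μ` are divisible
by `μ`. -/
theorem eq_aeval_mul_of_map_eq_zero {ψ : O →ₐ[K] K} {μ : K[X]} (hμ : μ.Monic)
    (hμR : μ ∈ liftsRing R.subtype) (hroot : eval (ψ b) μ = 0)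
    (hindep : ∀ p : ι → K[X], (∀ i, p i ∈ liftsRing R.subtype) → (∀ i, (p i).degree < μ.degree) →
      ∑ i, (p i).eval (ψ b) * ψ (y i) = 0 → ∀ i, p i = 0)
    {f : O} (hf : f ∈ coordGroup R b y) (h0 : ψ f = 0) :
    ∃ h ∈ coordGroup R b y, f = aeval b μ * h := by
  obtain ⟨p, hp, rfl⟩ := hf
  have h1 : ∀ i, p i %ₘ μ = 0 := by
    refine hindep _ (fun i => (divByMonic_mem_liftsRing (hp i) hμ hμR).2)
      (fun i => degree_modByMonic_lt _ hμ) ?_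
    rw [← h0, map_sum]
    refine Finset.sum_congr rfl fun i _ => ?_
    rw [map_mul, ← aeval_algHom_apply, coe_aeval_eq_eval]
    congr 1
    conv_rhs => rw [← modByMonic_add_div (p i) μ]
    simp [hroot]
  refine ⟨∑ i, aeval b (p i /ₘ μ) * y i,
    ⟨_, fun i => (divByMonic_mem_liftsRing (hp i) hμ hμR).1, rfl⟩, ?_⟩
  rw [Finset.mul_sum]
  refine Finset.sum_congr rfl fun i _ => ?_
  rw [← mul_assoc, ← map_mul]
  congr 2
  have := modByMonic_add_div (p i) μ
  rw [h1, zero_add] at this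
  exact this.symm

theorem exists_valuationSubring_of_place {W₁ : ValuationSubring K} (hRW : ∀ c ∈ R, c ∈ W₁)
    (hinv : ∀ c ∈ R, W₁.valuation c = 1 → c⁻¹ ∈ R)
    (h1 : 1 ∈ coordGroup R b y) (hmul : ∀ i j, y i * y j ∈ coordGroup R b y)
    {ψ : O →ₐ[K] K} {μ : K[X]} (hμ : μ.Monic)
    (hμR : μ ∈ liftsRing R.subtype) (hroot : eval (ψ b) μ = 0)
    (hindep : ∀ p : ι → K[X], (∀ i, p i ∈ liftsRing R.subtype) → (∀ i, (p i).degree < μ.degree) →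
      ∑ i, (p i).eval (ψ b) * ψ (y i) = 0 → ∀ i, p i = 0)
    {ev : O →ₐ[K] K} (hb : ev b ∈ R) (hy : ∀ i, ev (y i) ∈ R)
    (hev : W₁.valuation (eval (ev b) μ) < 1) :
    ∃ V : ValuationSubring K,
      (∀ f ∈ coordGroup R b y, ev f = 0 → V.valuation (ψ f) < 1) ∧
      ∀ f ∈ coordGroup R b y, W₁.valuation (ev f) = 1 → V.valuation (ψ f) = 1 := by
  have hle : ∀ f ∈ coordGroup R b y, W₁.valuation (ev f) ≤ 1 := fun f hf =>
    (W₁.valuation_le_one_iff _).2 (hRW _ (evaluation_mem hb hy hf))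
  have hker : ∀ f ∈ coordGroup R b y, ψ f = 0 → W₁.valuation (ev f) < 1 := by
    intro f hf h0
    obtain ⟨h, hh, rfl⟩ := eq_aeval_mul_of_map_eq_zero hμ hμR hroot hindep hf h0
    rw [map_mul, ← aeval_algHom_apply, coe_aeval_eq_eval, map_mul]
    exact (mul_le_of_le_one_right' (hle h hh)).trans_lt hev
  let B := coordRing h1 hmul
  let ψB : B →+* K := (ψ : O →+* K).comp B.subtype
  let I : Ideal ψB.range :=
    { carrier := {z | ∃ f : B, W₁.valuation (ev f) < 1 ∧ ψ f = z}
      zero_mem' := ⟨0, by simp, by simp⟩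
      add_mem' := by
        rintro _ _ ⟨f, hf, hf'⟩ ⟨g, hg, hg'⟩
        refine ⟨f + g, ?_, by simp [hf', hg']⟩
        rw [Subring.coe_add, map_add]
        exact W₁.valuation.map_add_lt hf hg
      smul_mem' := by
        rintro ⟨_, g, rfl⟩ z ⟨f, hf, hf'⟩
        refine ⟨g * f, ?_, by simp [hf', ψB]⟩
        rw [Subring.coe_mul, map_mul, map_mul]
        exact (mul_le_of_le_one_left' (hle g g.2)).trans_lt hf }
  have hI : I ≠ ⊤ := by
    rw [Ideal.ne_top_iff_one]
    rintro ⟨f, hf, hf'⟩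
    have h2 := hker (1 - f) (sub_mem h1 f.2) (by rw [map_sub, hf']; simp)
    have h3 := W₁.valuation.map_add_lt h2 hf
    rw [← map_add, sub_add_cancel, map_one, map_one] at h3
    exact lt_irrefl _ h3
  obtain ⟨V, hV, hIV⟩ := Ideal.image_subset_nonunits_valuationSubring I hI
  have hlt : ∀ f ∈ coordGroup R b y, W₁.valuation (ev f) < 1 → V.valuation (ψ f) < 1 :=
    fun f hf hf' => V.mem_nonunits_iff.1
      (hIV ⟨⟨ψ f, ⟨f, hf⟩, rfl⟩, ⟨⟨f, hf⟩, hf', rfl⟩, rfl⟩)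
  have hmem : ∀ f ∈ coordGroup R b y, V.valuation (ψ f) ≤ 1 := fun f hf =>
    (V.valuation_le_one_iff _).2 (hV ⟨⟨f, hf⟩, rfl⟩)
  refine ⟨V, fun f hf h0 => hlt f hf (by simp [h0]), fun f hf h => ?_⟩
  have hc := evaluation_mem hb hy hf
  set c := ev f with hcdef
  have hc0 : c ≠ 0 := by
    intro h0
    simp [h0] at h
  have e1 : V.valuation c ≤ 1 := by
    simpa using hmem _ (algebraMap_mem_coordGroup h1 hc)
  have e2 : V.valuation c⁻¹ ≤ 1 := by
    simpa using hmem _ (algebraMap_mem_coordGroup h1 (hinv c hc h))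
  have e3 : V.valuation c = 1 := by
    refine le_antisymm e1 ?_
    rw [map_inv₀] at e2
    exact (inv_le_one₀ (by simpa [zero_lt_iff] using hc0)).1 e2
  have e4 : V.valuation (ψ (f - algebraMap K O c)) < 1 :=
    hlt _ (sub_mem hf (algebraMap_mem_coordGroup h1 hc)) (by simp [hcdef])
  rw [map_sub, AlgHom.commutes, ← e3] at e4
  have := V.valuation.map_add_eq_of_lt_right e4
  rw [← e3, ← this]
  simp

end CoordinateRing

end Specialization

namespace Specialization

open Polynomial IsDedekindDomain IntermediateField

section GradedPresentation

variable {K L : Type*} [Field K] [IsAlgClosed K] [CharZero K] [Field L] [Algebra K L]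

theorem exists_graded_presentation {t : L} (ht : Transcendental K t)
    [FiniteDimensional K⟮t⟯ L] :
    ∃ (b : L) (v : Valuation L (WithZero (Multiplicative ℤ))) (m : ℕ) (ι : Type)
      (_ : Fintype ι) (y : ι → affineRing K b) (d : ι → ℕ) (β : affineRing K b),
      (β : L) = b ∧ Transcendental K b ∧
      (∀ f ∈ affineRing K b, v f ≤ 1 → ∃ c : K, algebraMap K L c = f) ∧ m ≠ 0 ∧
      (∀ i j, d i % m = d j % m → i = j) ∧
      (∀ f, ∃ p : ι → K[X], f = ∑ i, aeval β (p i) * y i) ∧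
      ∀ i, ∃ (c : K) (p : ι → K[X]), c ≠ 0 ∧
        y i ^ m = algebraMap K _ c * β ^ d i + ∑ j, aeval β (p j) * y j ∧
        ∀ j k, (p j).coeff k ≠ 0 → m * k + d j < m * d i := by
  obtain ⟨b, v, hv, hb, hres, hconst⟩ := exists_unique_pole ht
  obtain ⟨m, ι, _, y, d, hm, hbm, hyO, hyd, hd, hspan⟩ :=
    exists_graded_generators hv hb hres hconst
  have hcoe : ∀ p : ι → K[X],
      ((∑ i, aeval (⟨b, self_mem_affineRing b⟩ : affineRing K b) (p i) *
        (⟨y i, hyO i⟩ : affineRing K b) : affineRing K b) : L) = ∑ i, aeval b (p i) * y i := by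
    intro p
    rw [AddSubmonoidClass.coe_finsetSum]
    refine Finset.sum_congr rfl fun i _ => ?_
    rw [MulMemClass.coe_mul]
    congr 1
    exact (aeval_algHom_apply (affineRing K b).val _ (p i)).symm
  refine ⟨b, v, m, ι, inferInstance, fun i => ⟨y i, hyO i⟩, d, ⟨b, self_mem_affineRing b⟩, rfl,
    transcendental_of_one_lt v hv hb, hconst, hm.ne', hd, fun f => ?_, fun i => ?_⟩
  · obtain ⟨D, hD⟩ : ∃ D : ℕ, v f < WithZero.exp (D : ℤ) := by
      by_cases h0 : v f = 0
      · exact ⟨0, by simp [h0]⟩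
      · refine ⟨(WithZero.log (v f)).toNat + 1, ?_⟩
        rw [← WithZero.exp_log h0, WithZero.exp_lt_exp]
        simp
    obtain ⟨p, hp, -⟩ := hspan D f f.2 hD
    exact ⟨p, Subtype.ext (hp.trans (hcoe p).symm)⟩
  · have hb0 : v b ≠ 0 := (zero_lt_one.trans hb).ne'
    have hbd : v (b ^ d i) = WithZero.exp ((m * d i : ℕ) : ℤ) := by
      rw [map_pow, hbm, ← WithZero.exp_nsmul]
      simp [mul_comm]
    have hym : v (y i ^ m) = v (b ^ d i) := by
      rw [hbd, map_pow, hyd, ← WithZero.exp_nsmul]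
      simp
    have hbd0 : v (b ^ d i) ≠ 0 := by rw [map_pow]; exact pow_ne_zero _ hb0
    have hbd0' : b ^ d i ≠ 0 := v.ne_zero_iff.1 hbd0
    have hq : v (y i ^ m / b ^ d i) = 1 := by rw [map_div₀, hym, div_self hbd0]
    obtain ⟨c, hc⟩ := hres _ hq.le
    have hc0 : c ≠ 0 := by
      rintro rfl
      rw [map_zero, sub_zero, hq] at hc
      exact lt_irrefl _ hc
    obtain ⟨p, hp, hp'⟩ := hspan (m * d i) (y i ^ m - algebraMap K L c * b ^ d i)
      (sub_mem (pow_mem (hyO i) _)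
        (mul_mem (algebraMap_mem _ _) (pow_mem (self_mem_affineRing b) _))) (by
        have : y i ^ m - algebraMap K L c * b ^ d i =
            (y i ^ m / b ^ d i - algebraMap K L c) * b ^ d i := by field_simp
        rw [this, map_mul, ← hbd]
        exact (mul_lt_mul_of_pos_right hc (zero_lt_iff.2 hbd0)).trans_eq (one_mul _))
    refine ⟨c, p, hc0, Subtype.ext ?_, hp'⟩
    rw [Subalgebra.coe_add, hcoe, ← hp]
    simp

end GradedPresentation

section Root

variable {K L : Type*} [Field K] [IsAlgClosed K] [CharZero K] [Field L] [Algebra K L]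

theorem exists_algHom_affineRing_apply_eq {b : L} (hb : Transcendental K b)
    [FiniteDimensional K⟮b⟯ L] {β : affineRing K b} (hβ : (β : L) = b) (t₀ : K) :
    ∃ ψ : affineRing K b →ₐ[K] K, ψ β = t₀ := by
  have := finiteType_affineRing (L := L) hb
  let e := Polynomial.algEquivOfTranscendental K b hb
  let φ : Algebra.adjoin K {b} →ₐ[K] K := (aeval t₀).comp (e.symm : _ →ₐ[K] K[X])
  have hφs : Function.Surjective φ := fun c => ⟨algebraMap K _ c, φ.commutes c⟩
  let I : Ideal (Algebra.adjoin K {b}) := RingHom.ker φ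
  have hI : I.IsMaximal := RingHom.ker_isMaximal_of_surjective φ hφs
  obtain ⟨Q, -, hQ, hQI⟩ := Ideal.exists_ideal_over_prime_of_isIntegral
    (S := affineRing K b) I ⊥ (by
      have : FaithfulSMul (Algebra.adjoin K {b}) (affineRing K b) := by
        rw [faithfulSMul_iff_algebraMap_injective]
        intro x y hxy
        exact Subtype.ext (congrArg (fun z : affineRing K b => (z : L)) hxy)
      rw [← RingHom.ker_eq_comap_bot, (RingHom.injective_iff_ker_eq_bot
        (algebraMap (Algebra.adjoin K {b}) (affineRing K b))).1
        (FaithfulSMul.algebraMap_injective _ _)]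
      exact bot_le)
  have : Q.IsMaximal := Ideal.isMaximal_of_isIntegral_of_isMaximal_comap Q (hQI ▸ hI)
  obtain ⟨ψ, hψ⟩ := exists_residue_hom (K := K) Q
  refine ⟨ψ, ?_⟩
  have h1 : (⟨b, Algebra.self_mem_adjoin_singleton K b⟩ - algebraMap K _ t₀ :
      Algebra.adjoin K {b}) ∈ I := by
    rw [RingHom.mem_ker, map_sub]
    have : e X = ⟨b, Algebra.self_mem_adjoin_singleton K b⟩ := by
      apply Subtype.ext
      simp [e]
    rw [← this]
    simp [φ]
  rw [← hQI, Ideal.mem_comap, ← hψ, RingHom.mem_ker, map_sub] at h1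
  have h2 : algebraMap (Algebra.adjoin K {b}) (affineRing K b)
      ⟨b, Algebra.self_mem_adjoin_singleton K b⟩ = β := Subtype.ext hβ.symm
  rw [h2, ← IsScalarTower.algebraMap_apply, map_sub, sub_eq_zero] at h1
  simpa using h1

end Root

end Specialization

namespace Specialization

open Polynomial

section NonDegenerate

theorem prod_X_sub_C_mem_liftsRing {K σ : Type*} [Field K] {R : Subring K} {s : Finset σ}
    {a : σ → K} (ha : ∀ i ∈ s, a i ∈ R) (n : ℕ) :
    X ^ n * ∏ i ∈ s, (X - C (a i)) ∈ liftsRing R.subtype :=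
  have hX : (X : K[X]) ∈ liftsRing R.subtype := ⟨X, by simp⟩
  mul_mem (pow_mem hX n) (prod_mem fun i hi => sub_mem hX (C_mem_liftsRing (ha i hi)))

/-- A root of a large constant perturbation of a monic polynomial with small coefficients. -/
theorem exists_root_valuation_pow_eq {K : Type*} [Field K] [IsAlgClosed K]
    (W : ValuationSubring K) {G : K[X]} (hG : G.Monic) (hG0 : G.natDegree ≠ 0)
    (hGW : G ∈ liftsRing W.toSubring.subtype) {c : K} (hc : 1 < W.valuation c) :
    ∃ t₀, eval t₀ (G + C c) = 0 ∧ 1 < W.valuation t₀ ∧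
      W.valuation t₀ ^ G.natDegree = W.valuation c := by
  have hcoeff : ∀ i, W.valuation (G.coeff i) ≤ 1 := fun i =>
    (W.valuation_le_one_iff _).2 (mem_liftsRing_iff.1 hGW i)
  obtain ⟨t₀, ht₀⟩ := IsAlgClosed.exists_root (G + C c) (by
    rw [degree_eq_natDegree (by
      intro h
      have := congrArg natDegree h
      rw [natDegree_add_C] at this
      exact hG0 (by simpa using this)), natDegree_add_C]
    exact_mod_cast hG0)
  have hGt : eval t₀ G = -c := by
    rw [IsRoot.def, eval_add, eval_C] at ht₀
    exact eq_neg_of_add_eq_zero_left ht₀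
  have ht : 1 < W.valuation t₀ := by
    by_contra! h
    have : eval t₀ G ∈ W := by
      rw [eval_eq_sum_range]
      exact sum_mem fun i _ => mul_mem ((W.valuation_le_one_iff _).1 (hcoeff i))
        (pow_mem ((W.valuation_le_one_iff _).1 h) _)
    rw [hGt, ← W.valuation_le_one_iff, Valuation.map_neg] at this
    exact absurd hc this.not_gt
  refine ⟨t₀, ht₀, ht, ?_⟩
  rw [← valuation_eval_of_one_lt W.valuation ht hcoeff (by simp [hG.leadingCoeff]), hGt,
    Valuation.map_neg]

variable {K O ι : Type*} [Field K] [IsAlgClosed K] [CharZero K] [CommRing O] [Algebra K O]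
  [Fintype ι]

theorem exists_nondegenerate_specialization {β : O} {y : ι → O} {d : ι → ℕ} {m : ℕ}
    (hm : m ≠ 0) (hd : ∀ i j, d i % m = d j % m → i = j)
    (hspan : ∀ f, ∃ p : ι → K[X], f = ∑ i, aeval β (p i) * y i)
    (hpow : ∀ i, ∃ (c : K) (p : ι → K[X]), c ≠ 0 ∧
      y i ^ m = algebraMap K _ c * β ^ d i + ∑ j, aeval β (p j) * y j ∧
      ∀ j k, (p j).coeff k ≠ 0 → m * k + d j < m * d i)
    (hroot : ∀ t₀ : K, ∃ ψ : O →ₐ[K] K, ψ β = t₀)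
    {X : Set O} (hX : X.Finite) (E : Finset (O →ₐ[K] K)) :
    ∃ ψ : O →ₐ[K] K, (∀ f ∈ AddSubgroup.closure X, ψ f = 0 → f = 0) ∧
      ∀ ev ∈ E, ∃ V : ValuationSubring K, (∀ f ∈ X, ev f = 0 → V.valuation (ψ f) < 1) ∧
        ∀ f ∈ X, ev f ≠ 0 → V.valuation (ψ f) = 1 := by
  classical
  choose co hco using hspan
  choose c p hc0 hpy hpd using hpow
  let Y : Set O := X ∪ {1} ∪ {β} ∪ Set.range y ∪ Set.range fun z : ι × ι => y z.1 * y z.2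
  have hY : Y.Finite := (((hX.union (Set.finite_singleton _)).union
    (Set.finite_singleton _)).union (Set.finite_range _)).union (Set.finite_range _)
  let S₁ : Set K := ⋃ f ∈ Y, ⋃ i, ((co f i).coeffs : Set K)
  let S₂ : Set K := ⋃ i, ⋃ j, ((p i j).coeffs : Set K)
  let S₃ : Set K := ⋃ ev ∈ E, ev '' Y
  have hS : (S₁ ∪ S₂ ∪ S₃ ∪ Set.range c).Finite := by
    refine Set.Finite.union (Set.Finite.union (Set.Finite.union ?_ ?_) ?_) (Set.finite_range _)
    · exact hY.biUnion fun f _ => Set.finite_iUnion fun i => Finset.finite_toSet _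
    · exact Set.finite_iUnion fun i => Set.finite_iUnion fun j => Finset.finite_toSet _
    · exact E.finite_toSet.biUnion fun ev _ => hY.image _
  obtain ⟨F, W₀, W₁, ϖ, u, hSF, hϖF, huF, hSW, hϖ₀, hϖ₁, hu₀, hu₁, hϖ, hF⟩ :=
    exists_two_valuations hS
  have hS₀ : ∀ s, s ∈ S₁ ∪ S₂ ∪ S₃ ∪ Set.range c → s ∈ W₀ ∧ s ∈ W₁ := by
    intro s hs
    by_cases h0 : s = 0
    · exact h0 ▸ ⟨zero_mem _, zero_mem _⟩
    · exact ⟨(W₀.valuation_le_one_iff _).1 (hSW s hs h0).1.le,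
        (W₁.valuation_le_one_iff _).1 (hSW s hs h0).2.le⟩
  let A : Subring K := F.toSubring ⊓ W₁.toSubring
  have hSA : ∀ s, s ∈ S₁ ∪ S₂ ∪ S₃ ∪ Set.range c → s ∈ A := fun s hs =>
    ⟨hSF hs, (hS₀ s hs).2⟩
  have hcoA : ∀ f ∈ Y, ∀ i, co f i ∈ liftsRing A.subtype := by
    intro f hf i
    rw [mem_liftsRing_iff]
    intro k
    by_cases h : (co f i).coeff k = 0
    · exact h ▸ zero_mem _
    · refine hSA _ (Or.inl (Or.inl (Or.inl ?_)))
      exact Set.mem_biUnion hf (Set.mem_iUnion.2 ⟨i, coeff_mem_coeffs h⟩)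
  have hYA : ∀ f ∈ Y, f ∈ coordGroup A β y := fun f hf => ⟨co f, hcoA f hf, hco f⟩
  have hevS : ∀ ev ∈ E, ∀ f ∈ Y, ev f ∈ S₁ ∪ S₂ ∪ S₃ ∪ Set.range c := fun ev hev f hf =>
    Or.inl (Or.inr (Set.mem_biUnion hev ⟨f, hf, rfl⟩))
  have hXY : ∀ f ∈ X, f ∈ Y := fun f hf => Or.inl (Or.inl (Or.inl (Or.inl hf)))
  have h1Y : (1 : O) ∈ Y := Or.inl (Or.inl (Or.inl (Or.inr rfl)))
  have hβY : β ∈ Y := Or.inl (Or.inl (Or.inr rfl))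
  have hyY : ∀ i, y i ∈ Y := fun i => Or.inl (Or.inr ⟨i, rfl⟩)
  have hyyY : ∀ i j, y i * y j ∈ Y := fun i j => Or.inr ⟨(i, j), rfl⟩
  obtain ⟨N, hN⟩ : ∃ N, ∀ f ∈ X, ∀ i, (co f i).natDegree < N := by
    obtain ⟨N, hN⟩ := (hX.biUnion fun f _ => Set.finite_range
      fun i => (co f i).natDegree).bddAbove
    exact ⟨N + 1, fun f hf i => Nat.lt_succ_of_le
      (hN (Set.mem_biUnion hf ⟨i, rfl⟩))⟩
  let G : K[X] := Polynomial.X ^ (N + 1) * ∏ ev ∈ E, (Polynomial.X - C (ev β))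
  have hGm : G.Monic := (monic_X_pow _).mul (monic_prod_of_monic _ _ fun i _ => monic_X_sub_C _)
  obtain ⟨q, hq⟩ : ∃ q, q = G.natDegree := ⟨_, rfl⟩
  have hNq : N < q := by
    rw [hq, (monic_X_pow _).natDegree_mul (monic_prod_of_monic _ _ fun i _ => monic_X_sub_C _),
      natDegree_X_pow]
    omega
  have hq0 : G.natDegree ≠ 0 := by omega
  have huϖ₀ : W₀.valuation (u / ϖ) * W₀.valuation ϖ = 1 := by
    rw [← map_mul, div_mul_cancel₀ _ hϖ, hu₀]
  have huϖ₀' : 1 < W₀.valuation (u / ϖ) := by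
    rw [map_div₀, hu₀, one_div]
    exact (one_lt_inv₀ (zero_lt_iff.2 (W₀.valuation.ne_zero_iff.2 hϖ))).2 hϖ₀
  have huϖ₁ : W₁.valuation (u / ϖ) < 1 := by rwa [map_div₀, hϖ₁, div_one]
  have huϖA : u / ϖ ∈ A := ⟨F.div_mem huF hϖF, (W₁.valuation_le_one_iff _).1 huϖ₁.le⟩
  obtain ⟨t₀, ht₀, ht₁, htq⟩ := exists_root_valuation_pow_eq W₀ hGm hq0
    (prod_X_sub_C_mem_liftsRing (fun ev hev => (hS₀ _ (hevS ev hev β hβY)).1) _) huϖ₀'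
  have hμm : (G + C (u / ϖ)).Monic := hGm.add_of_left
    (degree_C_le.trans_lt (natDegree_pos_iff_degree_pos.1 (Nat.pos_of_ne_zero hq0)))
  have hμA : G + C (u / ϖ) ∈ liftsRing A.subtype :=
    add_mem (prod_X_sub_C_mem_liftsRing (fun ev hev => hSA _ (hevS ev hev β hβY)) _)
      (C_mem_liftsRing huϖA)
  have hμd : (G + C (u / ϖ)).degree = q := by
    rw [degree_eq_natDegree hμm.ne_zero, natDegree_add_C, hq]
  obtain ⟨τ, hτ⟩ := IsAlgClosed.exists_pow_nat_eq t₀ (Nat.pos_of_ne_zero hm)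
  have hτ1 : 1 < W₀.valuation τ := by
    rw [← hτ, map_pow] at ht₁
    exact (one_lt_pow_iff hm).1 ht₁
  obtain ⟨ψ, hψ⟩ := hroot t₀
  have hψβ : ψ β = τ ^ m := hψ.trans hτ.symm
  have hψy : ∀ i, W₀.valuation (ψ (y i)) = W₀.valuation τ ^ d i := by
    refine valuation_eq_pow_of_relations W₀.valuation hm hτ1 (c := c) (p := p) ?_ ?_ hpd ?_
    · exact fun i => (hSW _ (Or.inr ⟨i, rfl⟩) (hc0 i)).1
    · intro i j k
      rw [W₀.valuation_le_one_iff]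
      by_cases h : (p i j).coeff k = 0
      · exact h ▸ zero_mem _
      · refine (hS₀ _ (Or.inl (Or.inl (Or.inr ?_)))).1
        exact Set.mem_iUnion.2 ⟨i, Set.mem_iUnion.2 ⟨j, coeff_mem_coeffs h⟩⟩
    · intro i
      rw [← map_pow, hpy, map_add, map_mul, map_pow, hψβ, AlgHom.commutes, map_sum]
      congr 1
      refine Finset.sum_congr rfl fun j _ => ?_
      rw [map_mul, ← aeval_algHom_apply, hψβ, coe_aeval_eq_eval]
  have hinj : ∀ r : ι → K[X], (∀ i k, (r i).coeff k ∈ F) → (∀ i, (r i).degree < q) →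
      ∑ i, (r i).eval (ψ β) * ψ (y i) = 0 → ∀ i, r i = 0 := by
    intro r hr hrq h
    rw [hψβ] at h
    refine eq_zero_of_sum_eval_eq_zero W₀.valuation hm hτ1 ?_ hF hd hψy hr hrq h
    rw [hτ, hq, htq, huϖ₀]
  refine ⟨ψ, ?_, ?_⟩
  · have hcl : ∀ f ∈ AddSubgroup.closure X, ∃ r : ι → K[X], (∀ i k, (r i).coeff k ∈ F) ∧
        (∀ i, (r i).degree < q) ∧ f = ∑ i, aeval β (r i) * y i := by
      intro f hf
      induction hf using AddSubgroup.closure_induction with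
      | mem f hf =>
        refine ⟨co f, fun i k => (mem_liftsRing_iff.1 (hcoA f (hXY f hf) i) k).1, fun i => ?_,
          hco f⟩
        exact degree_le_natDegree.trans_lt (by exact_mod_cast (hN f hf i).trans hNq)
      | zero => exact ⟨0, by simp, by simp, by simp⟩
      | add f g _ _ hf hg =>
        obtain ⟨r, hr, hr', rfl⟩ := hf
        obtain ⟨s, hs, hs', rfl⟩ := hg
        refine ⟨r + s, fun i k => ?_, fun i => ?_, ?_⟩
        · rw [Pi.add_apply, coeff_add]
          exact add_mem (hr i k) (hs i k)
        · exact (degree_add_le _ _).trans_lt (max_lt (hr' i) (hs' i))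
        · simp [add_mul, Finset.sum_add_distrib]
      | neg f _ hf =>
        obtain ⟨r, hr, hr', rfl⟩ := hf
        refine ⟨-r, fun i k => ?_, fun i => ?_, ?_⟩
        · rw [Pi.neg_apply, coeff_neg]
          exact neg_mem (hr i k)
        · rw [Pi.neg_apply, degree_neg]
          exact hr' i
        · simp
    intro f hf h0
    obtain ⟨r, hrF, hrq, rfl⟩ := hcl f hf
    have := hinj r hrF hrq (by
      rw [← h0, map_sum]
      refine Finset.sum_congr rfl fun i _ => ?_
      rw [map_mul, ← aeval_algHom_apply, coe_aeval_eq_eval])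
    simp [this]
  · intro ev hev
    obtain ⟨V, hV, hV'⟩ := exists_valuationSubring_of_place (R := A) (W₁ := W₁)
      (fun c hc => hc.2) (fun c hc h => ⟨F.inv_mem hc.1, (W₁.valuation_le_one_iff _).1 (by
        rw [map_inv₀, h, inv_one])⟩) (hYA 1 h1Y) (fun i j => hYA _ (hyyY i j)) (ψ := ψ) hμm hμA
      (by rw [hψ, ht₀]) (fun r hr hr' h => hinj r (fun i k => (mem_liftsRing_iff.1 (hr i) k).1)
        (fun i => (hr' i).trans_eq hμd) h) (ev := ev) (hSA _ (hevS ev hev β hβY))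
      (fun i => hSA _ (hevS ev hev _ (hyY i))) (by
        have : eval (ev β) G = 0 := by
          simp only [G, eval_mul, eval_prod]
          rw [Finset.prod_eq_zero hev (by simp), mul_zero]
        rwa [eval_add, this, zero_add, eval_C])
    exact ⟨V, fun f hf h => hV f (hYA f (hXY f hf)) h, fun f hf h =>
      hV' f (hYA f (hXY f hf)) (hSW _ (hevS ev hev f (hXY f hf)) h).2⟩

end NonDegenerate

end Specialization

namespace Specialization

open Polynomial IsDedekindDomain IntermediateField

section LocalRelation

theorem exists_mul_uniformizer_pow_eq {O L : Type*} [CommRing O] [IsDedekindDomain O] [Field L]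
    [Algebra O L] [IsFractionRing O L] (P : HeightOneSpectrum O) {π : O}
    (hπ : P.valuation L (algebraMap O L π) = WithZero.exp (-1 : ℤ)) {x : L} (hx : x ≠ 0) :
    ∃ (e₁ e₂ : ℕ) (f h : O), f ∉ P.asIdeal ∧ h ∉ P.asIdeal ∧
      x * algebraMap O L h * algebraMap O L π ^ e₁ =
        algebraMap O L f * algebraMap O L π ^ e₂ := by
  have hx0 : P.valuation L x ≠ 0 := (Valuation.ne_zero_iff _).2 hx
  have hπ0 : algebraMap O L π ≠ 0 := by
    rw [← Valuation.ne_zero_iff (P.valuation L), hπ]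
    exact WithZero.exp_ne_zero
  set n := WithZero.log (P.valuation L x) with hn
  have hz : P.valuation L (x * algebraMap O L π ^ n.toNat / algebraMap O L π ^ (-n).toNat) = 1 := by
    rw [map_div₀, map_mul, map_pow, map_pow, hπ, ← WithZero.exp_log hx0, ← hn,
      ← WithZero.exp_nsmul, ← WithZero.exp_nsmul, ← WithZero.exp_add, ← WithZero.exp_sub,
      ← WithZero.exp_zero, WithZero.exp_inj]
    simp
    omega
  obtain ⟨f, h, hfh⟩ := P.exists_primeCompl_mul_eq_of_integer _ hz.le
  have hh : P.valuation L (algebraMap O L h) = 1 := P.valuation_eq_one_iff_notMem.2 h.2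
  refine ⟨n.toNat, (-n).toNat, f, h, ?_, h.2, ?_⟩
  · rw [← P.valuation_eq_one_iff_notMem (K := L)]
    rw [← hfh, map_mul, hz, hh, one_mul]
  · rw [← hfh]
    field_simp

theorem valuation_prod_zpow {L Γ₀ σ : Type*} [Field L] [LinearOrderedCommGroupWithZero Γ₀]
    [Fintype σ] (v : Valuation L Γ₀) {x : σ → L} {r : Γ₀} (hr : r ≠ 0) {o : σ → ℤ}
    (hx : ∀ i, v (x i) = r ^ o i) (n : σ → ℤ) :
    v (∏ i, x i ^ n i) = r ^ ∑ i, o i * n i := by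
  classical
  rw [map_prod]
  have : ∀ s : Finset σ, ∏ i ∈ s, v (x i ^ n i) = r ^ ∑ i ∈ s, o i * n i := by
    intro s
    induction s using Finset.induction_on with
    | empty => simp
    | insert a s ha ih =>
      rw [Finset.prod_insert ha, Finset.sum_insert ha, ih, zpow_add₀ hr, map_zpow₀, hx, zpow_mul]
  exact this _

theorem valuation_eq_zpow_of_mul_pow_eq {L Γ₀ : Type*} [Field L]
    [LinearOrderedCommGroupWithZero Γ₀] (v : Valuation L Γ₀) {x h π f : L} {e₁ e₂ : ℕ}
    (hh : v h = 1) (hf : v f = 1) (hπ : π ≠ 0) (h1 : x * h * π ^ e₁ = f * π ^ e₂) :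
    v x = v π ^ ((e₂ : ℤ) - e₁) := by
  have hπ0 : v π ≠ 0 := v.ne_zero_iff.2 hπ
  have := congrArg v h1
  rw [map_mul, map_mul, map_mul, hh, hf, map_pow, map_pow, mul_one, one_mul] at this
  rw [zpow_sub₀ hπ0, zpow_natCast, zpow_natCast, ← this,
    mul_div_cancel_right₀ _ (pow_ne_zero _ hπ0)]

theorem exists_extension_to_localization {K O L : Type*} [Field K] [CommRing O] [IsDomain O]
    [Field L] [Algebra K O] [Algebra O L] [Algebra K L] [IsScalarTower K O L]
    [IsFractionRing O L] (ψ : O →ₐ[K] K) :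
    ∃ (R : Subalgebra K L) (ψ' : R →ₐ[K] K), ∀ a d : O, ψ d ≠ 0 →
      ∃ h : algebraMap O L a / algebraMap O L d ∈ R, ψ' ⟨_, h⟩ = ψ a / ψ d := by
  have : (RingHom.ker ψ).IsPrime := RingHom.ker_isPrime ψ
  let S : Submonoid O := (RingHom.ker ψ).primeCompl
  have hS : S ≤ nonZeroDivisors O := Ideal.primeCompl_le_nonZeroDivisors _
  let R := Localization.subalgebra.ofField L S hS
  have hu : ∀ d : S, IsUnit (ψ d) := fun d => isUnit_iff_ne_zero.2 fun h => d.2 h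
  let φ : R →ₐ[K] K := IsLocalization.liftAlgHom hu
  refine ⟨R.restrictScalars K, φ, fun a d hd => ⟨⟨a, d, hd, div_eq_mul_inv _ _⟩, ?_⟩⟩
  have hφ : ∀ z : O, φ (algebraMap O R z) = ψ z := fun z =>
    IsLocalization.lift_eq (M := S) hu z
  have hd0 : algebraMap O L d ≠ 0 := by
    rw [Ne, FaithfulSMul.algebraMap_eq_zero_iff]
    rintro rfl
    exact hd (map_zero ψ)
  rw [eq_div_iff hd, ← hφ a, ← hφ d]
  refine (map_mul φ _ _).symm.trans (congrArg φ (Subtype.ext ?_))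
  exact div_mul_cancel₀ _ hd0

end LocalRelation

end Specialization

namespace Specialization

open Polynomial IsDedekindDomain IntermediateField

/-- The finite family `s` has a `K`-valued specialization which preserves all additive and
all multiplicative `ℤ`-relations and creates no new ones. -/
def Specializable (K : Type*) {L σ : Type*} [Field K] [Field L] [Algebra K L] [Fintype σ]
    (s : σ → L) : Prop :=
  ∃ (R : Subalgebra K L) (ψ : R →ₐ[K] K) (x : σ → Rˣ), (∀ i, ((x i : R) : L) = s i) ∧
    (∀ n : σ → ℤ, ∑ i, n i • ψ (x i) = 0 → ∑ i, n i • s i = 0) ∧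
    ∀ n : σ → ℤ, ∏ i, ψ (x i) ^ n i = 1 → ∏ i, s i ^ n i = 1

theorem map_prod_zpow_units {R F σ : Type*} [CommRing R] [Field F] [Fintype σ] (φ : R →+* F)
    (x : σ → Rˣ) (n : σ → ℤ) :
    φ ((∏ i, x i ^ n i : Rˣ) : R) = ∏ i, φ (x i) ^ n i := by
  have h1 : ∀ u : Rˣ, φ (u : R) = (Units.map (φ : R →* F) u : F) := fun _ => rfl
  rw [h1, map_prod, Units.coe_prod]
  refine Finset.prod_congr rfl fun i _ => ?_
  rw [map_zpow, Units.val_zpow_eq_zpow_val, h1]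

theorem finite_setOf_valuation_ne_one {O L σ : Type*} [CommRing O] [IsDedekindDomain O] [Field L]
    [Algebra O L] [IsFractionRing O L] [Finite σ] (s : σ → L) (hs : ∀ i, s i ≠ 0) :
    {P : HeightOneSpectrum O | ∃ i, P.valuation L (s i) ≠ 1}.Finite := by
  refine (Set.finite_iUnion fun i => (HeightOneSpectrum.Support.finite O (s i)).union
    (HeightOneSpectrum.Support.finite O (s i)⁻¹)).subset ?_
  rintro P ⟨i, hi⟩
  refine Set.mem_iUnion.2 ⟨i, ?_⟩
  rcases hi.lt_or_gt with h | h
  · refine Or.inr ?_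
    change 1 < P.valuation L (s i)⁻¹
    rw [map_inv₀]
    exact (one_lt_inv₀ (zero_lt_iff.2 ((Valuation.ne_zero_iff _).2 (hs i)))).2 h
  · exact Or.inl h

variable {K L σ : Type*} [Field K] [IsAlgClosed K] [CharZero K] [Field L] [Algebra K L]
  [Fintype σ]

theorem specializable_of_finiteDimensional {t : L} (ht : Transcendental K t)
    [FiniteDimensional K⟮t⟯ L] (s : σ → L) (hs : ∀ i, s i ≠ 0) : Specializable K s := by
  classical
  obtain ⟨b, v, m, ι, _, y, d, β, hβ, hb, hconst, hm, hd, hspan, hpow⟩ :=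
    exists_graded_presentation (L := L) ht
  have := finiteDimensional_adjoin_of_transcendental ht hb
  have := isDedekindDomain_affineRing (L := L) hb
  have := finiteType_affineRing (L := L) hb
  set O := affineRing K b with hO
  have hinjO : Function.Injective (algebraMap O L) := FaithfulSMul.algebraMap_injective O L
  obtain ⟨g, hg⟩ := IsLocalization.exist_integer_multiples_of_finite (nonZeroDivisors O) s
  have hg0 : (g : O) ≠ 0 := nonZeroDivisors.ne_zero g.2
  choose a ha using hg
  have ha' : ∀ i, algebraMap O L (a i) = algebraMap O L g * s i := fun i => by
    rw [ha, Algebra.smul_def]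
  have hgL : algebraMap O L g ≠ 0 := (map_ne_zero_iff _ hinjO).2 hg0
  have ha0 : ∀ i, a i ≠ 0 := fun i h => by
    have := ha' i
    rw [h, map_zero] at this
    exact mul_ne_zero hgL (hs i) this.symm
  choose ev hev using fun P : HeightOneSpectrum O => by
    have := P.isMaximal
    exact exists_residue_hom (K := K) P.asIdeal
  have hev' : ∀ P z, ev P z = 0 ↔ z ∈ P.asIdeal := fun P z => by
    rw [← hev P]; rfl
  choose π hπ using fun P : HeightOneSpectrum O => P.intValuation_exists_uniformizer
  have hπ' : ∀ P : HeightOneSpectrum O,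
      P.valuation L (algebraMap O L (π P)) = WithZero.exp (-1 : ℤ) := fun P => by
    rw [P.valuation_of_algebraMap, hπ]
  choose e₁ e₂ f h hf hh hrel using fun (P : HeightOneSpectrum O) i =>
    exists_mul_uniformizer_pow_eq P (hπ' P) (hs i)
  have hB := finite_setOf_valuation_ne_one (O := O) s hs
  set B := {P : HeightOneSpectrum O | ∃ i, P.valuation L (s i) ≠ 1}
  let X : Set O := {(g : O)} ∪ Set.range a ∪
    ⋃ P ∈ B, ({π P} ∪ Set.range (f P) ∪ Set.range (h P))
  have hX : X.Finite := ((Set.finite_singleton _).union (Set.finite_range _)).union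
    (hB.biUnion fun P _ => ((Set.finite_singleton _).union (Set.finite_range _)).union
      (Set.finite_range _))
  obtain ⟨ψ, hψ, hV⟩ := exists_nondegenerate_specialization hm hd hspan hpow
    (exists_algHom_affineRing_apply_eq hb hβ) hX (hB.toFinset.image ev)
  have hgX : (g : O) ∈ X := Or.inl (Or.inl rfl)
  have haX : ∀ i, a i ∈ X := fun i => Or.inl (Or.inr ⟨i, rfl⟩)
  have hπX : ∀ P ∈ B, π P ∈ X := fun P hP =>
    Or.inr (Set.mem_biUnion hP (Or.inl (Or.inl rfl)))
  have hfX : ∀ P ∈ B, ∀ i, f P i ∈ X := fun P hP i =>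
    Or.inr (Set.mem_biUnion hP (Or.inl (Or.inr ⟨i, rfl⟩)))
  have hhX : ∀ P ∈ B, ∀ i, h P i ∈ X := fun P hP i =>
    Or.inr (Set.mem_biUnion hP (Or.inr ⟨i, rfl⟩))
  have hψX : ∀ z ∈ X, z ≠ 0 → ψ z ≠ 0 := fun z hz hz0 h0 =>
    hz0 (hψ z (AddSubgroup.subset_closure hz) h0)
  have hψg := hψX g hgX hg0
  have hψa := fun i => hψX (a i) (haX i) (ha0 i)
  obtain ⟨R, ψ', hR⟩ := exists_extension_to_localization (L := L) ψ
  have hsa : ∀ i, algebraMap O L (a i) / algebraMap O L g = s i := fun i => by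
    rw [ha', mul_div_cancel_left₀ _ hgL]
  have hsa' : ∀ i, algebraMap O L g / algebraMap O L (a i) = (s i)⁻¹ := fun i => by
    rw [← hsa, inv_div]
  choose hsR hsψ using fun i => hR (a i) g hψg
  choose hsR' hsψ' using fun i => hR g (a i) (hψa i)
  let x : σ → Rˣ := fun i =>
    ⟨⟨_, hsR i⟩, ⟨_, hsR' i⟩,
      Subtype.ext (by
        change _ / _ * (_ / _) = (1 : L)
        rw [hsa, hsa', mul_inv_cancel₀ (hs i)]),
      Subtype.ext (by
        change _ / _ * (_ / _) = (1 : L)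
        rw [hsa, hsa', inv_mul_cancel₀ (hs i)])⟩
  have hxs : ∀ i, ((x i : R) : L) = s i := hsa
  have hxψ : ∀ i, ψ' (x i) = ψ (a i) / ψ g := hsψ
  have hψ'0 : ∀ i, ψ' (x i) ≠ 0 := fun i => by
    rw [hxψ]
    exact div_ne_zero (hψa i) hψg
  refine ⟨R, ψ', x, hxs, fun n hn => ?_, ?_⟩
  · have h1 : ψ (∑ i, n i • a i) = 0 := by
      have h2 : ψ (∑ i, n i • a i) = ψ g * ∑ i, n i • ψ' (x i) := by
        rw [map_sum, Finset.mul_sum]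
        refine Finset.sum_congr rfl fun i _ => ?_
        rw [map_zsmul, hxψ, mul_smul_comm, mul_div_cancel₀ _ hψg]
      rw [h2, hn, mul_zero]
    have h2 := hψ _ (sum_mem fun i _ => zsmul_mem (AddSubgroup.subset_closure (haX i)) _) h1
    have h3 := congrArg (algebraMap O L) h2
    rw [map_sum, map_zero] at h3
    have h4 : algebraMap O L g * ∑ i, n i • s i = 0 := by
      rw [← h3, Finset.mul_sum]
      refine Finset.sum_congr rfl fun i _ => ?_
      rw [map_zsmul, ha', mul_smul_comm]
    exact (mul_eq_zero.1 h4).resolve_left hgL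
  have hval : ∀ n : σ → ℤ, ∏ i, ψ' (x i) ^ n i = 1 → ∀ P : HeightOneSpectrum O,
      P.valuation L (∏ i, s i ^ n i) = 1 := by
    intro n hn P
    by_cases hP : P ∈ B
    · obtain ⟨V, hV₁, hV₂⟩ := hV (ev P) (Finset.mem_image_of_mem _ (hB.mem_toFinset.2 hP))
      have hπ0 : π P ≠ 0 := by
        intro h0
        have := hπ' P
        rw [h0, map_zero, map_zero] at this
        exact WithZero.exp_ne_zero this.symm
      have hπψ := hψX _ (hπX P hP) hπ0
      have hVπ : V.valuation (ψ (π P)) < 1 := by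
        refine hV₁ _ (hπX P hP) ((hev' _ _).2 ?_)
        rw [← P.valuation_lt_one_iff_mem (K := L), hπ' P, ← WithZero.exp_zero,
          WithZero.exp_lt_exp]
        norm_num
      have h1 : ∀ i, V.valuation (ψ' (x i)) =
          V.valuation (ψ (π P)) ^ ((e₂ P i : ℤ) - e₁ P i) := by
        intro i
        refine valuation_eq_zpow_of_mul_pow_eq V.valuation
          (hV₂ _ (hhX P hP i) (mt (hev' _ _).1 (hh P i)))
          (hV₂ _ (hfX P hP i) (mt (hev' _ _).1 (hf P i))) hπψ ?_
        have h2 : a i * h P i * π P ^ e₁ P i = g * (f P i * π P ^ e₂ P i) := by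
          apply hinjO
          rw [map_mul, map_mul, map_pow, map_mul, map_mul, map_pow, ← hrel, ha']
          ring
        have h3 := congrArg ψ h2
        rw [map_mul, map_mul, map_pow, map_mul, map_mul, map_pow] at h3
        rw [hxψ]
        field_simp
        rw [h3]
        ring
      have h2 : ∀ i, P.valuation L (s i) =
          P.valuation L (algebraMap O L (π P)) ^ ((e₂ P i : ℤ) - e₁ P i) := fun i =>
        valuation_eq_zpow_of_mul_pow_eq _ (P.valuation_eq_one_iff_notMem.2 (hh P i))
          (P.valuation_eq_one_iff_notMem.2 (hf P i)) ((map_ne_zero_iff _ hinjO).2 hπ0) (hrel P i)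
      have hr : V.valuation (ψ (π P)) ≠ 0 := V.valuation.ne_zero_iff.2 hπψ
      have h3 := valuation_prod_zpow V.valuation hr h1 n
      rw [hn, map_one] at h3
      have h4 := (zpow_eq_one_iff_right₀ zero_le hVπ.ne).1 h3.symm
      rw [valuation_prod_zpow _ (by rw [hπ']; exact WithZero.exp_ne_zero) h2 n, h4, zpow_zero]
    · have h1 : ∀ i, P.valuation L (s i) = 1 ^ (0 : ℤ) := fun i => by
        by_contra hi
        exact hP ⟨i, by simpa using hi⟩
      rw [valuation_prod_zpow _ one_ne_zero h1 n, one_zpow]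
  have hψprod : ∀ n : σ → ℤ, ∀ c : K, algebraMap K L c = ∏ i, s i ^ n i →
      c = ∏ i, ψ' (x i) ^ n i := by
    intro n c hc
    have h1 : algebraMap K R c = ((∏ i, x i ^ n i : Rˣ) : R) := by
      apply Subtype.ext
      change algebraMap K L c = R.val _
      rw [hc]
      refine Eq.trans ?_ (map_prod_zpow_units (R.val : R →+* L) x n).symm
      exact Finset.prod_congr rfl fun i _ => by rw [← hxs i]; rfl
    have h2 := congrArg ψ' h1
    rw [AlgHom.commutes] at h2
    exact h2.trans (map_prod_zpow_units (ψ' : R →+* K) x n)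
  have key : ∀ n : σ → ℤ, ∏ i, ψ' (x i) ^ n i = 1 → v (∏ i, s i ^ n i) ≤ 1 →
      ∏ i, s i ^ n i = 1 := by
    intro n hn hvn
    obtain ⟨z, hz⟩ := HeightOneSpectrum.mem_integers_of_valuation_le_one (R := O) L
      (∏ i, s i ^ n i) (fun P => (hval n hn P).le)
    obtain ⟨c, hc⟩ := hconst (z : L) z.2 (by
      change v (algebraMap O L z) ≤ 1
      rwa [hz])
    have hc' : algebraMap K L c = ∏ i, s i ^ n i := hc.trans hz
    rw [← hc', hψprod n c hc', hn, map_one]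
  intro n hn
  rcases le_total (v (∏ i, s i ^ n i)) 1 with h1 | h1
  · exact key n hn h1
  · have h2 := key (-n) (by simp [hn]) (by
      simp only [Pi.neg_apply, zpow_neg, Finset.prod_inv_distrib, map_inv₀]
      exact inv_le_one_of_one_le₀ h1)
    simpa using h2

end Specialization

namespace Specialization

open Polynomial IntermediateField

section Algebraic

theorem isAlgebraic_of_isAlgebraic_adjoin {K F Ω : Type*} [Field K] [Field F] [Field Ω]
    [Algebra K Ω] [Algebra F Ω] {S : Set Ω}
    (hK : ∀ c : K, algebraMap K Ω c ∈ (algebraMap F Ω).fieldRange)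
    (hS : ∀ z ∈ S, z ∈ (algebraMap F Ω).fieldRange) {z : Ω}
    (hz : IsAlgebraic (IntermediateField.adjoin K S) z) : IsAlgebraic F z := by
  have hle : ∀ w ∈ IntermediateField.adjoin K S, w ∈ (algebraMap F Ω).fieldRange := by
    intro w hw
    induction hw using IntermediateField.adjoin_induction with
    | mem w hw => exact hS w hw
    | algebraMap c => exact hK c
    | add _ _ _ _ h₁ h₂ => exact add_mem h₁ h₂
    | inv _ _ h => exact inv_mem h
    | mul _ _ _ _ h₁ h₂ => exact mul_mem h₁ h₂
  obtain ⟨p, hp, hpz⟩ := hz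
  obtain ⟨q, hq⟩ : p.map (algebraMap _ Ω) ∈ lifts (algebraMap F Ω) := by
    rw [lifts_iff_coeff_lifts]
    intro n
    rw [coeff_map]
    exact hle _ (p.coeff n).2
  rw [coe_mapRingHom] at hq
  refine ⟨q, ?_, ?_⟩
  · rintro rfl
    rw [Polynomial.map_zero] at hq
    exact hp ((Polynomial.map_eq_zero _).1 hq.symm)
  · rw [aeval_def, eval₂_eq_eval_map, hq, ← eval₂_eq_eval_map, ← aeval_def, hpz]

theorem finiteDimensional_adjoin_of_isAlgebraic {E Ω : Type*} [Field E] [Field Ω] [Algebra E Ω]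
    {S : Set Ω} (hS : S.Finite) (t : IntermediateField.adjoin E S)
    (h : ∀ z ∈ S, IsAlgebraic E⟮t⟯ z) : FiniteDimensional E⟮t⟯ (IntermediateField.adjoin E S) := by
  have h1 : IntermediateField.adjoin E S ≤ (algebraicClosure E⟮t⟯ Ω).restrictScalars E :=
    adjoin_le_iff.2 fun z hz => mem_algebraicClosure_iff.2 (h z hz)
  have : Algebra.IsAlgebraic E⟮t⟯ (IntermediateField.adjoin E S) := ⟨fun z =>
    (isAlgebraic_algebraMap_iff (algebraMap (IntermediateField.adjoin E S) Ω).injective).1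
      (mem_algebraicClosure_iff.1 (h1 z.2))⟩
  have : Algebra.EssFiniteType E (IntermediateField.adjoin E S) :=
    essFiniteType_iff.2 ⟨hS.toFinset, by simp⟩
  have : Algebra.EssFiniteType E⟮t⟯ (IntermediateField.adjoin E S) :=
    Algebra.EssFiniteType.of_comp E _ _
  exact Algebra.finite_of_essFiniteType_of_isAlgebraic

end Algebraic

section Composition

variable {K E L Ω σ : Type*} [Field K] [Field E] [Field L] [Field Ω] [Fintype σ]

theorem Specializable.of_injective [Algebra K L] {C : Type*} [CommRing C] [Algebra K C]
    (j : C →ₐ[K] L) (hj : Function.Injective j) (ψ : C →ₐ[K] K) (x : σ → Cˣ) {s : σ → L}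
    (hs : ∀ i, j (x i) = s i) (hadd : ∀ n : σ → ℤ, ∑ i, n i • ψ (x i) = 0 → ∑ i, n i • s i = 0)
    (hmul : ∀ n : σ → ℤ, ∏ i, ψ (x i) ^ n i = 1 → ∏ i, s i ^ n i = 1) : Specializable K s := by
  let e := AlgEquiv.ofInjective j hj
  have he : ∀ c, e.symm (e c) = c := e.symm_apply_apply
  refine ⟨j.range, ψ.comp (e.symm : j.range →ₐ[K] C),
    fun i => Units.map (e : C →* j.range) (x i), hs, fun n hn => hadd n ?_, fun n hn => hmul n ?_⟩
  · simpa [he] using hn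
  · simpa [he] using hn

theorem Specializable.map [Algebra K L] [Algebra K Ω] {s : σ → L} (h : Specializable K s)
    (f : L →ₐ[K] Ω) : Specializable K (fun i => f (s i)) := by
  obtain ⟨R, ψ, x, hx, hadd, hmul⟩ := h
  refine .of_injective (f.comp R.val) (f.injective.comp Subtype.val_injective) ψ x
    (fun i => congrArg f (hx i)) (fun n hn => ?_) (fun n hn => ?_)
  · have := congrArg f (hadd n hn)
    simpa using this
  · have := congrArg f (hmul n hn)
    simpa using this

/-- Specializing first to `E` and then to `K`. -/
theorem Specializable.trans [Algebra K E] [Algebra E Ω] [Algebra K Ω] [IsScalarTower K E Ω]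
    {s : σ → Ω} (h : Specializable E s)
    (hE : ∀ c : σ → E, (∀ i, c i ≠ 0) → Specializable K fun i => algebraMap E Ω (c i)) :
    Specializable K s := by
  obtain ⟨R, ψ, x, hx, hadd, hmul⟩ := h
  obtain ⟨R', ψ', x', hx', hadd', hmul'⟩ := hE (fun i => ψ (x i))
    (fun i => ((x i).isUnit.map ψ).ne_zero)
  replace hx' : ∀ i, ((x' i : R') : Ω) = algebraMap E Ω (ψ (x i)) := hx'
  let θ : R →ₐ[K] Ω := (IsScalarTower.toAlgHom K E Ω).comp (ψ.restrictScalars K)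
  let C : Subalgebra K R := R'.comap θ
  let φ : C →ₐ[K] R' := (θ.comp C.val).codRestrict R' fun c => c.2
  have hφ : ∀ c : C, ((φ c : R') : Ω) = algebraMap E Ω (ψ c) := fun c => rfl
  have hC : ∀ i, ((x i : R)) ∈ C := fun i => by
    change algebraMap E Ω (ψ (x i)) ∈ R'
    rw [← hx']
    exact SetLike.coe_mem _
  have hC' : ∀ i, (((x i)⁻¹ : Rˣ) : R) ∈ C := fun i => by
    have h1 : algebraMap E Ω (ψ ((x i)⁻¹ : Rˣ)) = (((x' i)⁻¹ : R'ˣ) : R') := by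
      have h2 : algebraMap E Ω (ψ (x i)) * algebraMap E Ω (ψ ((x i)⁻¹ : Rˣ)) = 1 := by
        rw [← map_mul, ← map_mul, Units.mul_inv, map_one, map_one]
      have h3 : algebraMap E Ω (ψ (x i)) * ((((x' i)⁻¹ : R'ˣ) : R') : Ω) = 1 := by
        rw [← hx', ← MulMemClass.coe_mul, Units.mul_inv, OneMemClass.coe_one]
      exact mul_left_cancel₀ (left_ne_zero_of_mul_eq_one h2) (h2.trans h3.symm)
    change algebraMap E Ω (ψ ((x i)⁻¹ : Rˣ)) ∈ R'
    rw [h1]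
    exact SetLike.coe_mem _
  let X : σ → Cˣ := fun i => ⟨⟨x i, hC i⟩, ⟨_, hC' i⟩, Subtype.ext (Units.mul_inv _),
    Subtype.ext (Units.inv_mul _)⟩
  have hX : ∀ i, φ (X i) = x' i := fun i => Subtype.ext ((hx' i).symm)
  refine .of_injective ((R.val.restrictScalars K).comp C.val)
    (Subtype.val_injective.comp Subtype.val_injective) (ψ'.comp φ) X hx (fun n hn => ?_)
    (fun n hn => ?_)
  · refine hadd n ((algebraMap E Ω).injective ?_)
    simp only [AlgHom.comp_apply, hX] at hn
    rw [map_zero, ← hadd' n hn]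
    simp
  · refine hmul n ((algebraMap E Ω).injective ?_)
    simp only [AlgHom.comp_apply, hX] at hn
    rw [map_one, ← hmul' n hn]
    simp

theorem specializable_of_mem_range [Algebra K L] {s : σ → L} (hs : ∀ i, s i ≠ 0)
    (h : ∀ i, ∃ c : K, algebraMap K L c = s i) : Specializable K s := by
  choose c hc using h
  have hc0 : ∀ i, c i ≠ 0 := fun i h0 => hs i (by rw [← hc, h0, map_zero])
  refine .of_injective (Algebra.ofId K L) (algebraMap K L).injective (AlgHom.id K K)
    (fun i => Units.mk0 (c i) (hc0 i)) hc (fun n hn => ?_) (fun n hn => ?_)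
  · have := congrArg (algebraMap K L) hn
    simpa [hc] using this
  · have := congrArg (algebraMap K L) hn
    simpa [hc] using this

end Composition

section Tower

variable {K Ω σ : Type*} [Field K] [IsAlgClosed K] [CharZero K] [Field Ω] [IsAlgClosed Ω]
  [Algebra K Ω] [Fintype σ]

theorem specializable_of_isAlgebraic_adjoin (T : Finset Ω) :
    ∀ s : σ → Ω, (∀ i, s i ≠ 0) →
      (∀ i, IsAlgebraic (IntermediateField.adjoin K (T : Set Ω)) (s i)) → Specializable K s := by
  classical
  induction T using Finset.induction_on with
  | empty =>
    intro s hs halg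
    refine specializable_of_mem_range hs fun i => ?_
    have h1 : IsAlgebraic K (s i) := isAlgebraic_of_isAlgebraic_adjoin (fun c => ⟨c, rfl⟩)
      (by simp) (halg i)
    exact IsAlgClosed.algebraMap_bijective_of_isIntegral.2
      (⟨s i, (mem_algebraicClosure_iff).2 h1⟩ : algebraicClosure K Ω) |>.imp
        fun c hc => congrArg Subtype.val hc
  | insert x T _ ih =>
    intro s hs halg
    let M := IntermediateField.adjoin K (T : Set Ω)
    let E := algebraicClosure M Ω
    have : IsAlgClosed E := IsAlgClosure.isAlgClosed M
    have : CharZero E := charZero_of_injective_algebraMap (algebraMap K E).injective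
    have : IsScalarTower K E Ω := .of_algebraMap_eq fun _ => rfl
    by_cases hx : x ∈ E
    · refine ih s hs fun i => ?_
      have h1 : IsAlgebraic E (s i) := isAlgebraic_of_isAlgebraic_adjoin
        (fun c => ⟨algebraMap K E c, rfl⟩) (fun z hz => ?_) (halg i)
      · exact h1.restrictScalars M
      · rw [Finset.coe_insert, Set.mem_insert_iff] at hz
        rcases hz with rfl | hz
        · exact ⟨⟨z, hx⟩, rfl⟩
        · exact ⟨algebraMap M E ⟨z, subset_adjoin _ _ hz⟩, rfl⟩
    · have hS : (insert x (Set.range s)).Finite := (Set.finite_range s).insert x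
      let L := IntermediateField.adjoin E (insert x (Set.range s))
      let t : L := ⟨x, subset_adjoin _ _ (Set.mem_insert _ _)⟩
      have ht : Transcendental E t := by
        intro h1
        have h2 : IsAlgebraic E x := h1.algebraMap
        exact hx (mem_algebraicClosure_iff.2 (h2.restrictScalars M))
      have : FiniteDimensional E⟮t⟯ L := by
        refine finiteDimensional_adjoin_of_isAlgebraic hS t fun z hz => ?_
        have hxt : x ∈ (algebraMap E⟮t⟯ Ω).fieldRange := ⟨AdjoinSimple.gen E t, rfl⟩
        rcases hz with rfl | ⟨i, rfl⟩
        · obtain ⟨w, hw⟩ := hxt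
          have h1 := isAlgebraic_algebraMap (A := Ω) w
          rwa [hw] at h1
        · refine isAlgebraic_of_isAlgebraic_adjoin
            (fun c => ⟨algebraMap E _ (algebraMap K E c), rfl⟩) (fun z hz => ?_) (halg i)
          rw [Finset.coe_insert, Set.mem_insert_iff] at hz
          rcases hz with rfl | hz
          · exact hxt
          · exact ⟨algebraMap E _ (algebraMap M E ⟨z, subset_adjoin _ _ hz⟩), rfl⟩
      have h1 : Specializable E (fun i => (⟨s i, subset_adjoin _ _ (Or.inr ⟨i, rfl⟩)⟩ : L)) :=
        specializable_of_finiteDimensional ht _ fun i h0 => hs i (congrArg Subtype.val h0)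
      refine (h1.map L.val).trans fun c hc => ih _ (fun i => ?_) fun i => ?_
      · exact (map_ne_zero_iff _ (algebraMap E Ω).injective).2 (hc i)
      · exact mem_algebraicClosure_iff.1 (c i).2

theorem specializable_of_ne_zero (s : σ → Ω) (hs : ∀ i, s i ≠ 0) : Specializable K s := by
  classical
  refine specializable_of_isAlgebraic_adjoin (Finset.univ.image s) s hs fun i => ?_
  exact isAlgebraic_algebraMap (⟨s i, subset_adjoin _ _ (by simp)⟩ :
    IntermediateField.adjoin K ((Finset.univ.image s : Finset Ω) : Set Ω))

end Tower

end Specialization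

namespace Specialization

section Closure

variable {Ω : Type*} [Field Ω] {Z : Set Ω} [Fintype Z]

theorem exists_sum_zsmul_of_mem_closure {f : Ω} (hf : f ∈ AddSubgroup.closure Z) :
    ∃ n : Z → ℤ, ∑ z : Z, n z • (z : Ω) = f := by
  classical
  induction hf using AddSubgroup.closure_induction with
  | mem z hz =>
    exact ⟨Pi.single ⟨z, hz⟩ 1, by simp [Pi.single_apply, ite_smul, -zsmul_eq_mul]⟩
  | zero => exact ⟨0, by simp⟩
  | add _ _ _ _ h₁ h₂ =>
    obtain ⟨n, rfl⟩ := h₁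
    obtain ⟨m, rfl⟩ := h₂
    exact ⟨n + m, by simp only [Pi.add_apply, add_smul, Finset.sum_add_distrib]⟩
  | neg _ _ h =>
    obtain ⟨n, rfl⟩ := h
    exact ⟨-n, by simp only [Pi.neg_apply, neg_smul, Finset.sum_neg_distrib]⟩

theorem exists_prod_zpow_of_mem_closure (hZ : (0 : Ω) ∉ Z) {u : Ωˣ}
    (hu : u ∈ Subgroup.closure {u : Ωˣ | (u : Ω) ∈ Z}) :
    ∃ n : Z → ℤ, ∏ z : Z, (z : Ω) ^ n z = u := by
  classical
  have h0 : ∀ z : Z, (z : Ω) ≠ 0 := fun z hz => hZ (hz ▸ z.2)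
  induction hu using Subgroup.closure_induction with
  | mem z hz =>
    refine ⟨Pi.single ⟨z, hz⟩ 1, ?_⟩
    rw [Finset.prod_eq_single (⟨(z : Ω), hz⟩ : Z) (fun w _ hw => by simp [hw])
      (by simp)]
    simp
  | one => exact ⟨0, by simp⟩
  | mul _ _ _ _ h₁ h₂ =>
    obtain ⟨n, hn⟩ := h₁
    obtain ⟨m, hm⟩ := h₂
    refine ⟨n + m, ?_⟩
    rw [Units.val_mul, ← hn, ← hm, ← Finset.prod_mul_distrib]
    exact Finset.prod_congr rfl fun z _ => zpow_add₀ (h0 z) _ _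
  | inv _ _ h =>
    obtain ⟨n, hn⟩ := h
    exact ⟨-n, by simp [hn]⟩

end Closure

/-- A finite set of nonzero elements lies in a subalgebra with a `K`-point that is faithful both
on the additive and on the multiplicative group generated by the set. -/
theorem exists_faithful_specialization {K Ω : Type*} [Field K] [IsAlgClosed K] [CharZero K]
    [Field Ω] [IsAlgClosed Ω] [Algebra K Ω] {Z : Set Ω} (hfin : Z.Finite) (hZ : (0 : Ω) ∉ Z) :
    ∃ (R : Subalgebra K Ω) (ψ : R →ₐ[K] K), Z ⊆ R ∧
      (∀ f : R, (f : Ω) ∈ AddSubgroup.closure Z → ψ f = 0 → f = 0) ∧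
      (∀ u ∈ Subgroup.closure {u : Ωˣ | (u : Ω) ∈ Z}, (u : Ω) ∈ R) ∧
      ∀ f : R, ∀ u ∈ Subgroup.closure {u : Ωˣ | (u : Ω) ∈ Z}, (u : Ω) = f → ψ f = 1 → u = 1 := by
  have := hfin.fintype
  obtain ⟨R, ψ, x, hx, hadd, hmul⟩ := specializable_of_ne_zero (K := K) (Subtype.val : Z → Ω)
    fun z hz => hZ (hz ▸ z.2)
  have hprod : ∀ n : Z → ℤ, (((∏ z, x z ^ n z : Rˣ) : R) : Ω) = ∏ z : Z, (z : Ω) ^ n z := fun n => by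
    have := map_prod_zpow_units (R.val : R →+* Ω) x n
    simpa [hx] using this
  refine ⟨R, ψ, fun z hz => ?_, fun f hf h0 => ?_, fun u hu => ?_, fun f u hu huf h1 => ?_⟩
  · have := (x ⟨z, hz⟩ : R).2
    rwa [hx] at this
  · obtain ⟨n, hn⟩ := exists_sum_zsmul_of_mem_closure hf
    have hf' : f = ∑ z, n z • (x z : R) := Subtype.ext (by simp [hx, ← hn])
    refine Subtype.ext (hn.symm.trans (hadd n ?_))
    rw [← h0, hf']
    simp
  · obtain ⟨n, hn⟩ := exists_prod_zpow_of_mem_closure hZ hu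
    rw [← hn, ← hprod]
    exact SetLike.coe_mem _
  · obtain ⟨n, hn⟩ := exists_prod_zpow_of_mem_closure hZ hu
    have hf' : f = (∏ z, x z ^ n z : Rˣ) := Subtype.ext (by rw [hprod, hn, huf])
    refine Units.ext (hn.symm.trans (hmul n ?_))
    rw [← h1, hf']
    exact (map_prod_zpow_units (ψ : R →+* K) x n).symm

end Specialization

theorem IsFGAddOrMulSubgroup.exists_generators {Ω : Type*} [Field Ω] {Γ : Set Ω}
    (hΓ : IsFGAddOrMulSubgroup Γ) : ∃ Z : Set Ω, Z.Finite ∧ (0 : Ω) ∉ Z ∧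
      (Γ = AddSubgroup.closure Z ∨
        Γ = Units.val '' (Subgroup.closure {u : Ωˣ | (u : Ω) ∈ Z} : Set Ωˣ)) := by
  rcases hΓ with ⟨H, ⟨A, hA⟩, rfl⟩ | ⟨H, ⟨M, hM⟩, rfl⟩
  · refine ⟨(A : Set Ω) \ {0}, A.finite_toSet.sdiff, by simp, Or.inl ?_⟩
    rw [← hA, AddSubgroup.closure_sdiff_zero]
  · refine ⟨Units.val '' (M : Set Ωˣ), M.finite_toSet.image _, ?_, Or.inr ?_⟩
    · rintro ⟨u, _, hu⟩
      exact u.ne_zero hu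
    · have h1 : {u : Ωˣ | (u : Ω) ∈ Units.val '' (M : Set Ωˣ)} = M :=
        Set.preimage_image_eq _ Units.val_injective
      rw [h1, hM]

/-- Theorem 2.20 of the paper. If `k ⊆ Ω` is finitely generated over `ℚ`
as a field and `D ⊆ Ω` is a finitely generated `k`-algebra, then every basic open subset of
`Hom_k(D,k̄)` is nonempty. -/
theorem basicOpen_nonempty
    {Ω : Type*} [Field Ω] [IsAlgClosed Ω] [CharZero Ω]
    (k : Type*) [Field k] [Algebra k Ω] [CharZero k]
    (kbar : Type*) [Field kbar] [Algebra k kbar] [IsAlgClosure k kbar]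
    -- `k` is finitely generated over `ℚ` as a field
    (hkfin : ∃ s : Finset k, IntermediateField.adjoin ℚ (s : Set k) = ⊤)
    (D : Subalgebra k Ω) (hD : D.FG) :
    ∀ U : Set (↥D →ₐ[k] kbar), IsBasicOpen k kbar D U → U.Nonempty := by
  rintro U ⟨s, -, hs, rfl⟩
  choose! Z hfin hZ hΓ using fun Γ hΓ => (hs Γ hΓ).exists_generators
  obtain ⟨T, hT⟩ := hD
  let K := algebraicClosure k Ω
  have : IsAlgClosed K := IsAlgClosure.isAlgClosed k
  have : CharZero K := charZero_of_injective_algebraMap (algebraMap k K).injective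
  let e : K ≃ₐ[k] kbar := IsAlgClosure.equiv k K kbar
  obtain ⟨R, ψ, hR, hadd, hmem, hmul⟩ :=
    Specialization.exists_faithful_specialization (K := K) (Ω := Ω)
      (Z := ((T : Set Ω) \ {0}) ∪ ⋃ Γ ∈ s, Z Γ)
      (T.finite_toSet.sdiff.union (s.finite_toSet.biUnion hfin))
      (by simpa using hZ)
  have hZs : ∀ Γ ∈ s, Z Γ ⊆ ((T : Set Ω) \ {0}) ∪ ⋃ Γ ∈ s, Z Γ := fun Γ h =>
    (Set.subset_biUnion_of_mem (u := Z) (Finset.mem_coe.2 h)).trans Set.subset_union_right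
  have hadd' : ∀ Γ ∈ s, AddSubgroup.closure (Z Γ) ≤ AddSubgroup.closure
      (((T : Set Ω) \ {0}) ∪ ⋃ Γ ∈ s, Z Γ) := fun Γ h => AddSubgroup.closure_mono (hZs Γ h)
  have hmul' : ∀ Γ ∈ s, Subgroup.closure {u : Ωˣ | (u : Ω) ∈ Z Γ} ≤ Subgroup.closure
      {u : Ωˣ | (u : Ω) ∈ ((T : Set Ω) \ {0}) ∪ ⋃ Γ ∈ s, Z Γ} :=
    fun Γ h => Subgroup.closure_mono fun u hu => hZs Γ h hu
  let R' : Subalgebra k Ω := R.restrictScalars k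
  have hDR : D ≤ R' := by
    rw [← hT, Algebra.adjoin_le_iff]
    intro z hz
    by_cases h0 : z = 0
    · exact h0 ▸ zero_mem R'
    · exact hR (Or.inl ⟨hz, h0⟩)
  have hΓR : ∀ Γ ∈ s, Γ ⊆ (R' : Set Ω) := by
    intro Γ h
    rcases hΓ Γ h with h1 | h1
    · rw [h1]
      exact (AddSubgroup.closure_le (K := R'.toSubring.toAddSubgroup)).2 ((hZs Γ h).trans hR)
    · rw [h1]
      rintro _ ⟨u, hu, rfl⟩
      exact hmem u (hmul' Γ h hu)
  have hle : ∀ Γ ∈ s, algAdj k D Γ ≤ R' := fun Γ h =>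
    Algebra.adjoin_le (Set.union_subset hDR (hΓR Γ h))
  let θ : R' →ₐ[k] kbar := (e : K →ₐ[k] kbar).comp (ψ.restrictScalars k)
  refine ⟨θ.comp (Subalgebra.inclusion hDR), Set.mem_iInter₂.2 fun Γ h =>
    ⟨θ.comp (Subalgebra.inclusion (hle Γ h)), fun a b ha hb hab => ?_, rfl⟩⟩
  have hab' : ψ ⟨a, hΓR Γ h ha⟩ = ψ ⟨b, hΓR Γ h hb⟩ := e.injective hab
  rcases hΓ Γ h with h1 | h1
  · have h2 : a - b ∈ AddSubgroup.closure (Z Γ) := by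
      rw [h1] at ha hb
      exact sub_mem ha hb
    have h3 := hadd (⟨a, hΓR Γ h ha⟩ - ⟨b, hΓR Γ h hb⟩) (hadd' Γ h h2)
      (by rw [map_sub, hab', sub_self])
    exact congrArg Subtype.val (sub_eq_zero.1 h3)
  · obtain ⟨u, hu, rfl⟩ : a ∈ Units.val '' _ := h1 ▸ ha
    obtain ⟨w, hw, rfl⟩ : b ∈ Units.val '' _ := h1 ▸ hb
    have hw' : ((w⁻¹ : Ωˣ) : Ω) ∈ R := hmem _ (inv_mem (hmul' Γ h hw))
    have h2 : u * w⁻¹ = 1 := by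
      refine hmul (⟨u, hΓR Γ h ha⟩ * ⟨_, hw'⟩) (u * w⁻¹)
        (mul_mem (hmul' Γ h hu) (inv_mem (hmul' Γ h hw))) rfl ?_
      rw [map_mul, hab', ← map_mul, ← map_one ψ]
      exact congrArg ψ (Subtype.ext (Units.mul_inv w))
    exact congrArg Units.val (mul_inv_eq_one.1 h2)
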